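/- Let L and M be finitely generated S-modules. Then for almost all α and for all i ≥ 0 there are isomorphisms Ext^i_{S_α}(L_α, M_α) ≅ (Ext^i_S(L, M))_α and Tor_i^{S_α}(L_α, M_α) ≅ (Tor_i^S(L, M))_α, i.e. specialization commutes with the Ext and Tor functors. -/

import Mathlib

set_option maxHeartbeats 1000000
set_option synthInstance.maxHeartbeats 1000000

noncomputable section

namespace Spl

open MvPolynomial

/-- "Q(α) holds for almost all α ∈ K^m", i.e. away from a proper algebraic
subvariety of `K^m`. -/
def AlmostAll (K : Type) [Field K] (m : ℕ) (Q : (Fin m → K) → Prop) : Prop :=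
  ∃ c : MvPolynomial (Fin m) K, c ≠ 0 ∧ ∀ α : Fin m → K, MvPolynomial.eval α c ≠ 0 → Q α

variable (k K : Type) [Field k] [Field K] [Algebra k K]

/-- the field k(u) of rational functions in u = (u_1, ..., u_m) -/
abbrev kU (m : ℕ) := FractionRing (MvPolynomial (Fin m) k)

/-- the polynomial ring R = k(u)[X_1, ..., X_n] -/
abbrev Rg (m n : ℕ) := MvPolynomial (Fin n) (kU k m)

/-- the subfield k(α) ⊆ K generated by α = (α_1, ..., α_m) over k -/
abbrev kA {m : ℕ} (α : Fin m → K) := IntermediateField.adjoin k (Set.range α)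

/-- the polynomial ring R_α = k(α)[X_1, ..., X_n] -/
abbrev Ra {m : ℕ} (n : ℕ) (α : Fin m → K) := MvPolynomial (Fin n) (kA k K α)

/-- evaluation u ↦ α, from k[u] to k(α) -/
def evalα {m : ℕ} (α : Fin m → K) : MvPolynomial (Fin m) k →+* kA k K α :=
  (MvPolynomial.aeval fun i =>
    (⟨α i, IntermediateField.subset_adjoin k (Set.range α) ⟨i, rfl⟩⟩ : kA k K α)).toRingHom

/-- the inclusion k[u][X] → R = k(u)[X] -/
def toR (m n : ℕ) : MvPolynomial (Fin n) (MvPolynomial (Fin m) k) →+* Rg k m n :=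
  MvPolynomial.map (algebraMap (MvPolynomial (Fin m) k) (kU k m))

/-- substitution u ↦ α, from k[u][X] to R_α = k(α)[X] -/
def toRa {m : ℕ} (n : ℕ) (α : Fin m → K) :
    MvPolynomial (Fin n) (MvPolynomial (Fin m) k) →+* Ra k K n α :=
  MvPolynomial.map (evalα k K α)

/-- Krull's specialization I_α = { f(α,X) | f(u,X) ∈ I ∩ k[u,X] } of an ideal I ⊆ R
(as an ideal of R_α, i.e. the ideal spanned by the specialized elements). -/
def idealSpec {m : ℕ} (n : ℕ) (α : Fin m → K) (I : Ideal (Rg k m n)) :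
    Ideal (Ra k K n α) :=
  Ideal.span (toRa k K n α '' { f | toR k m n f ∈ I })

/-- `ElemSpec k K n α f fα` : fα is the specialization of f ∈ R at α, i.e. writing
f = p(u,X)/q(u) with q(α) ≠ 0 one has fα = p(α,X)/q(α). -/
def ElemSpec {m : ℕ} (n : ℕ) (α : Fin m → K) (f : Rg k m n) (fα : Ra k K n α) : Prop :=
  ∃ (p : MvPolynomial (Fin n) (MvPolynomial (Fin m) k)) (q : MvPolynomial (Fin m) k),
    evalα k K α q ≠ 0 ∧
    MvPolynomial.C (algebraMap (MvPolynomial (Fin m) k) (kU k m) q) * f = toR k m n p ∧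
    MvPolynomial.C (evalα k K α q) * fα = toRa k K n α p

variable {k K}

/-- `LocElemSpec P ℘ a aα` : aα ∈ S_α = (R_α)_℘ is the specialization of a ∈ S = R_P,
i.e. writing a = f/g with f, g ∈ R, g ∉ P, one has g_α ∉ ℘ and aα = f_α/g_α. -/
def LocElemSpec {m n : ℕ} {α : Fin m → K} (P : Ideal (Rg k m n)) [P.IsPrime]
    (℘ : Ideal (Ra k K n α)) [℘.IsPrime]
    {S : Type} [CommRing S] [Algebra (Rg k m n) S] [IsLocalization.AtPrime S P]
    {Sα : Type} [CommRing Sα] [Algebra (Ra k K n α) Sα] [IsLocalization.AtPrime Sα ℘]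
    (a : S) (aα : Sα) : Prop :=
  ∃ (f g : Rg k m n) (fα gα : Ra k K n α) (hg : g ∈ P.primeCompl)
    (hgα : gα ∈ ℘.primeCompl),
    ElemSpec k K n α f fα ∧ ElemSpec k K n α g gα ∧
    a = IsLocalization.mk' S f ⟨g, hg⟩ ∧
    aα = IsLocalization.mk' Sα fα ⟨gα, hgα⟩

/-- entrywise specialization of matrices, relative to an element-specialization
relation `E`. -/
def MatSpec {S T : Type} (E : S → T → Prop) {r s : ℕ}
    (A : Matrix (Fin r) (Fin s) S) (B : Matrix (Fin r) (Fin s) T) : Prop :=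
  ∀ i j, E (A i j) (B i j)

/-- the cokernel of the linear map attached to a matrix A, i.e. the module
presented by A. -/
abbrev MatCoker {S : Type} [CommRing S] {r s : ℕ} (A : Matrix (Fin r) (Fin s) S) :=
  (Fin r → S) ⧸ LinearMap.range A.mulVecLin

/-- a finite free presentation F_1 → F_0 → L → 0 of the module L, where the map
F_1 → F_0 is given by the matrix A and the map F_0 → L is π. -/
structure Present (S : Type) [CommRing S] (r s : ℕ) (L : Type) [AddCommGroup L]
    [Module S L] where
  A : Matrix (Fin r) (Fin s) S
  π : (Fin r → S) →ₗ[S] L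
  surj : Function.Surjective π
  ker_eq : LinearMap.ker π = LinearMap.range A.mulVecLin

theorem comm_le {S : Type} [CommRing S] {r s r' s' : ℕ} {B : Matrix (Fin r) (Fin s) S}
    {C : Matrix (Fin r') (Fin s') S} {W : Matrix (Fin r') (Fin r) S}
    {W1 : Matrix (Fin s') (Fin s) S} (h : W * B = C * W1) :
    LinearMap.range B.mulVecLin ≤ (LinearMap.range C.mulVecLin).comap W.mulVecLin := by
  rintro x ⟨y, rfl⟩
  exact ⟨W1.mulVecLin y, by
    simp only [Matrix.mulVecLin_apply, Matrix.mulVec_mulVec, h]⟩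

/-- the map between the modules presented by B and C induced by the matrix W
(a specialization of a lift of a map between the presented modules). -/
def cokerMap {S : Type} [CommRing S] {r s r' s' : ℕ} {B : Matrix (Fin r) (Fin s) S}
    {C : Matrix (Fin r') (Fin s') S} (W : Matrix (Fin r') (Fin r) S)
    (h : LinearMap.range B.mulVecLin ≤ (LinearMap.range C.mulVecLin).comap W.mulVecLin) :
    MatCoker B →ₗ[S] MatCoker C :=
  Submodule.mapQ _ _ W.mulVecLin h

/-- a lift of a homomorphism v : L → M to given finite free presentations of L and M:
a commutative diagram whose vertical maps are given by the matrices V1, V0. -/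
structure MapLift {S : Type} [CommRing S] {rL sL rM sM : ℕ} {L M : Type}
    [AddCommGroup L] [Module S L] [AddCommGroup M] [Module S M]
    (pL : Present S rL sL L) (pM : Present S rM sM M) (v : L →ₗ[S] M) where
  V0 : Matrix (Fin rM) (Fin rL) S
  V1 : Matrix (Fin sM) (Fin sL) S
  comm0 : pM.π ∘ₗ V0.mulVecLin = v ∘ₗ pL.π
  comm1 : V0 * pL.A = pM.A * V1

/-- Krull dimension of a module, dim L = dim S/Ann L. -/
def moduleDim (S : Type) [CommRing S] (L : Type) [AddCommGroup L] [Module S L] :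
    WithBot ℕ∞ :=
  ringKrullDim (S ⧸ Module.annihilator S L)

/-- height of an ideal: the infimum of dim S_p over the primes p ⊇ I. -/
def idealHeight {S : Type} [CommRing S] (I : Ideal S) : WithBot ℕ∞ :=
  sInf { d | ∃ (p : Ideal S) (hp : p.IsPrime), I ≤ p ∧
    d = ringKrullDim (Localization (@Ideal.primeCompl _ _ p hp)) }

/-- length of a module: the longest chain of submodules. -/
def moduleLength (S : Type) [CommRing S] (L : Type) [AddCommGroup L] [Module S L] :
    WithBot ℕ∞ :=
  Order.krullDim (Submodule S L)

/-- grade(𝔞, L) ≥ t : there is an L-regular sequence of length t in 𝔞. -/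
def GradeGE {S : Type} [CommRing S] (𝔞 : Ideal S) (L : Type) [AddCommGroup L]
    [Module S L] (t : ℕ) : Prop :=
  ∃ rs : List S, rs.length = t ∧ (∀ x ∈ rs, x ∈ 𝔞) ∧ RingTheory.Sequence.IsRegular L rs

/-- grade(𝔞, L) : the length of a maximal L-regular sequence in 𝔞. -/
def grade {S : Type} [CommRing S] (𝔞 : Ideal S) (L : Type) [AddCommGroup L]
    [Module S L] : ℕ∞ :=
  sSup { t : ℕ∞ | ∃ t' : ℕ, t = (t' : ℕ∞) ∧ GradeGE 𝔞 L t' }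

/-- depth of a module over a local ring: grade(𝔪, L). -/
def depth (S : Type) [CommRing S] [IsLocalRing S] (L : Type) [AddCommGroup L]
    [Module S L] : ℕ∞ :=
  grade (IsLocalRing.maximalIdeal S) L

/-- proj dim L ≤ d : L admits a finite free resolution of length ≤ d, encoded as a
(possibly infinite) free resolution ⋯ → F_1 → F_0 → L → 0 with F_j = 0 for j > d. -/
def ProjDimLE (S : Type) [CommRing S] (L : Type) [AddCommGroup L] [Module S L]
    (d : ℕ) : Prop :=
  ∃ (r : ℕ → ℕ) (A : ∀ j : ℕ, Matrix (Fin (r j)) (Fin (r (j + 1))) S)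
    (π : (Fin (r 0) → S) →ₗ[S] L),
    Function.Surjective π ∧ LinearMap.ker π = LinearMap.range (A 0).mulVecLin ∧
    (∀ j : ℕ, LinearMap.ker (A j).mulVecLin = LinearMap.range (A (j + 1)).mulVecLin) ∧
    ∀ j : ℕ, d < j → r j = 0

/-- projective dimension of a module, as an extended natural number. -/
def projDim (S : Type) [CommRing S] (L : Type) [AddCommGroup L] [Module S L] : ℕ∞ :=
  sInf { d : ℕ∞ | ∃ d' : ℕ, d = (d' : ℕ∞) ∧ ProjDimLE S L d' }

/-- the i-th local cohomology module H^i_𝔞(L) as a module. -/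
abbrev localCoh {S : Type} [CommRing S] (𝔞 : Ideal S) (i : ℕ) (L : Type)
    [AddCommGroup L] [Module S L] : ModuleCat S :=
  (localCohomology 𝔞 i).obj (ModuleCat.of S L)

/-- the colon submodule (0 :_L 𝔞) = { x ∈ L | 𝔞 x = 0 }. -/
def colonSubmodule {S : Type} [CommRing S] (𝔞 : Ideal S) (L : Type) [AddCommGroup L]
    [Module S L] : Submodule S L where
  carrier := { x | ∀ c ∈ 𝔞, c • x = 0 }
  add_mem' := by
    intro a b ha hb c hc
    rw [smul_add, ha c hc, hb c hc, add_zero]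
  zero_mem' := by
    intro c _
    rw [smul_zero]
  smul_mem' := by
    intro s x hx c hc
    rw [smul_comm, hx c hc, smul_zero]

/-- a (partial) system of parameters: the d = dim L elements a_1, ..., a_d lie in the
maximal ideal and L/(a_1, ..., a_d)L has dimension ≤ 0. -/
def IsSOP (S : Type) [CommRing S] [IsLocalRing S] (L : Type) [AddCommGroup L]
    [Module S L] {d : ℕ} (a : Fin d → S) : Prop :=
  (∀ i, a i ∈ IsLocalRing.maximalIdeal S) ∧
  moduleDim S L = (d : ℕ∞) ∧
  moduleDim S (L ⧸ (Ideal.span (Set.range a) • (⊤ : Submodule S L))) ≤ 0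

/-- a standard system of parameters: (a_1, ..., a_d) H^i_𝔪(L/(a_1, ..., a_j)L) = 0
for all i + j < d. -/
def IsStandardSOP (S : Type) [CommRing S] [IsLocalRing S] (L : Type) [AddCommGroup L]
    [Module S L] {d : ℕ} (a : Fin d → S) : Prop :=
  IsSOP S L a ∧
  ∀ i j : ℕ, i + j < d →
    Ideal.span (Set.range a) ≤ Module.annihilator S
      (localCoh (IsLocalRing.maximalIdeal S) i
        (L ⧸ (Ideal.span (a '' { x : Fin d | (x : ℕ) < j }) • (⊤ : Submodule S L))))

/-- a standard ideal for L: an 𝔪-primary ideal 𝔞 such that every system of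
parameters of L contained in 𝔞 is standard. -/
def IsStandardIdeal (S : Type) [CommRing S] [IsLocalRing S] (L : Type) [AddCommGroup L]
    [Module S L] (𝔞 : Ideal S) : Prop :=
  𝔞.radical = IsLocalRing.maximalIdeal S ∧
  ∀ (d : ℕ) (a : Fin d → S), (∀ i, a i ∈ 𝔞) → IsSOP S L a → IsStandardSOP S L a


section Division

variable {n : ℕ} {ρ A : Type} [CommRing A]

/-- The coefficient of a vector of polynomials at a position and an exponent. -/
def vcoeff (γ : ρ × (Fin n →₀ ℕ)) : (ρ → MvPolynomial (Fin n) A) →ₗ[A] A :=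
  lcoeff A γ.2 ∘ₗ LinearMap.proj γ.1

theorem vcoeff_apply (γ : ρ × (Fin n →₀ ℕ)) (x : ρ → MvPolynomial (Fin n) A) :
    vcoeff γ x = (x γ.1).coeff γ.2 := rfl

theorem eq_zero_of_vcoeff {x : ρ → MvPolynomial (Fin n) A} (h : ∀ γ, vcoeff γ x = 0) :
    x = 0 := by
  funext i
  ext m
  exact h (i, m)

theorem finite_vcoeff_ne_zero [Finite ρ] (x : ρ → MvPolynomial (Fin n) A) :
    {γ : ρ × (Fin n →₀ ℕ) | vcoeff γ x ≠ 0}.Finite := by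
  refine (Set.finite_iUnion fun i : ρ => ((x i).support.finite_toSet.image (Prod.mk i))).subset ?_
  rintro ⟨i, m⟩ h
  exact Set.mem_iUnion.2 ⟨i, m, by simpa [vcoeff_apply] using h, rfl⟩

variable [LinearOrder ρ]

/-- A term-over-position well-order on the monomials of a free module. -/
def termOrder (γ : ρ × (Fin n →₀ ℕ)) : (MonomialOrder.lex (σ := Fin n)).syn ×ₗ ρ :=
  toLex ((MonomialOrder.lex (σ := Fin n)).toSyn γ.2, γ.1)

omit [LinearOrder ρ] in
theorem termOrder_injective : Function.Injective (termOrder (n := n) (ρ := ρ)) := by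
  rintro ⟨i, a⟩ ⟨j, b⟩ h
  have := toLex.injective h
  simp only [Prod.mk.injEq, EmbeddingLike.apply_eq_iff_eq] at this
  ext1
  · exact this.2
  · exact this.1

theorem termOrder_add_le {i j : ρ} {a b : Fin n →₀ ℕ} (d : Fin n →₀ ℕ)
    (h : termOrder (i, a) ≤ termOrder (j, b)) :
    termOrder (i, d + a) ≤ termOrder (j, d + b) := by
  simp only [termOrder, Prod.Lex.toLex_le_toLex, map_add] at h ⊢
  simpa using h

/-- `x` has leading monomial `γ`. -/
def IsLead (x : ρ → MvPolynomial (Fin n) A) (γ : ρ × (Fin n →₀ ℕ)) : Prop :=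
  vcoeff γ x ≠ 0 ∧ ∀ δ, vcoeff δ x ≠ 0 → termOrder δ ≤ termOrder γ

theorem exists_isLead [Finite ρ] {x : ρ → MvPolynomial (Fin n) A} (hx : x ≠ 0) :
    ∃ γ, IsLead x γ := by
  have hne : {γ : ρ × (Fin n →₀ ℕ) | vcoeff γ x ≠ 0}.Nonempty := by
    by_contra h
    rw [Set.not_nonempty_iff_eq_empty] at h
    refine hx (eq_zero_of_vcoeff fun γ => ?_)
    by_contra hγ
    exact (h ▸ (show γ ∈ {γ : ρ × (Fin n →₀ ℕ) | vcoeff γ x ≠ 0} from hγ) : γ ∈ (∅ : Set _))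
  obtain ⟨γ, hγ, hmax⟩ := (finite_vcoeff_ne_zero x).exists_maximalFor termOrder _ hne
  refine ⟨γ, hγ, fun δ hδ => ?_⟩
  rcases le_total (termOrder δ) (termOrder γ) with h | h
  · exact h
  · exact hmax hδ h

omit [LinearOrder ρ] in
theorem vcoeff_monomial_smul_add (d : Fin n →₀ ℕ) (a : A) (x : ρ → MvPolynomial (Fin n) A)
    (i : ρ) (m : Fin n →₀ ℕ) :
    vcoeff (i, d + m) (monomial d a • x) = a * vcoeff (i, m) x := by
  simp [vcoeff_apply, coeff_monomial_mul]

omit [LinearOrder ρ] in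
theorem exists_of_vcoeff_monomial_smul {d : Fin n →₀ ℕ} {a : A}
    {x : ρ → MvPolynomial (Fin n) A} {δ : ρ × (Fin n →₀ ℕ)}
    (h : vcoeff δ (monomial d a • x) ≠ 0) :
    ∃ m, δ = (δ.1, d + m) ∧ vcoeff (δ.1, m) x ≠ 0 := by
  obtain ⟨i, e⟩ := δ
  simp only [vcoeff_apply, Pi.smul_apply, smul_eq_mul, coeff_monomial_mul'] at h
  split_ifs at h with hle
  · refine ⟨e - d, by rw [add_tsub_cancel_of_le hle], ?_⟩
    intro h0
    exact h (by rw [show coeff (e - d) (x i) = 0 from h0, mul_zero])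
  · exact absurd rfl h

/-- The set of leading monomials of elements of a submodule. -/
def leads (N : Submodule (MvPolynomial (Fin n) A) (ρ → MvPolynomial (Fin n) A)) :
    Set (ρ × (Fin n →₀ ℕ)) :=
  {γ | ∃ x ∈ N, IsLead x γ}

/-- Vectors all of whose monomials are standard, i.e. not leading monomials of `N`. -/
def standardVectors (N : Submodule (MvPolynomial (Fin n) A) (ρ → MvPolynomial (Fin n) A)) :
    Submodule A (ρ → MvPolynomial (Fin n) A) where
  carrier := {x | ∀ γ ∈ leads N, vcoeff γ x = 0}
  zero_mem' := by intro γ _; simp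
  add_mem' := by intro x y hx hy γ hγ; rw [map_add, hx γ hγ, hy γ hγ, add_zero]
  smul_mem' := by intro a x hx γ hγ; rw [map_smul, hx γ hγ, smul_zero]

theorem eq_zero_of_mem_standardVectors [Finite ρ]
    {N : Submodule (MvPolynomial (Fin n) A) (ρ → MvPolynomial (Fin n) A)}
    {x : ρ → MvPolynomial (Fin n) A} (hN : x ∈ N) (hs : x ∈ standardVectors N) : x = 0 := by
  by_contra hx
  obtain ⟨γ, hγ⟩ := exists_isLead hx
  exact hγ.1 (hs γ ⟨x, hN, hγ⟩)

/-- Dickson's lemma: finitely many elements of `N` have leading monomials dividing all others. -/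
theorem exists_finite_leads [Finite ρ]
    (N : Submodule (MvPolynomial (Fin n) A) (ρ → MvPolynomial (Fin n) A)) :
    ∃ T : Set (ρ × (Fin n →₀ ℕ)), T.Finite ∧ T ⊆ leads N ∧
      ∀ i m, (i, m) ∈ leads N → ∃ m' ≤ m, (i, m') ∈ T := by
  refine ⟨⋃ i : ρ, Prod.mk i '' {m | Minimal (fun m => (i, m) ∈ leads N) m}, ?_, ?_, ?_⟩
  · exact Set.finite_iUnion fun i => Set.Finite.image _
      (WellQuasiOrderedLE.finite_of_isAntichain (setOfPred_minimal_antichain _))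
  · rintro γ hγ
    obtain ⟨i, m, hm, rfl⟩ := Set.mem_iUnion.1 hγ
    exact hm.1
  · intro i m h
    obtain ⟨m', hm', hmin⟩ := exists_minimal_le_of_wellFoundedLT
      (fun m => (i, m) ∈ leads N) m h
    exact ⟨m', hm', Set.mem_iUnion.2 ⟨i, m', hmin, rfl⟩⟩

theorem exists_leadCoeff_dvd [Finite ρ] [IsDomain A]
    (N : Submodule (MvPolynomial (Fin n) A) (ρ → MvPolynomial (Fin n) A)) :
    ∃ c : A, c ≠ 0 ∧ ∀ i m, (i, m) ∈ leads N →
      ∃ d m' f, m = d + m' ∧ f ∈ N ∧ IsLead f (i, m') ∧ vcoeff (i, m') f ∣ c := by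
  obtain ⟨T, hT, hTN, hdiv⟩ := exists_finite_leads N
  have hT' : ∀ γ, γ ∈ T → ∃ x, x ∈ N ∧ IsLead x γ := fun γ hγ => hTN hγ
  choose! f hf using hT'
  refine ⟨∏ γ ∈ hT.toFinset, vcoeff γ (f γ), ?_, fun i m h => ?_⟩
  · exact Finset.prod_ne_zero_iff.2 fun γ hγ => (hf γ (hT.mem_toFinset.1 hγ)).2.1
  · obtain ⟨m', hm', hmT⟩ := hdiv i m h
    exact ⟨m - m', m', f (i, m'), (tsub_add_cancel_of_le hm').symm, (hf _ hmT).1, (hf _ hmT).2,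
      Finset.dvd_prod_of_mem (fun γ => vcoeff γ (f γ)) (hT.mem_toFinset.2 hmT)⟩

/-- Division with remainder by a submodule, with coefficients in an ideal. -/
theorem exists_division [Finite ρ] [IsDomain A]
    (N : Submodule (MvPolynomial (Fin n) A) (ρ → MvPolynomial (Fin n) A)) :
    ∃ c : A, c ≠ 0 ∧ ∀ (I : Ideal A) (x : ρ → MvPolynomial (Fin n) A), (∀ γ, vcoeff γ x ∈ I) →
      ∃ e : ℕ, ∃ y ∈ I • N.restrictScalars A, ∃ s ∈ standardVectors N, c ^ e • x = y + s := by
  obtain ⟨c, hc, hdiv⟩ := exists_leadCoeff_dvd N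
  refine ⟨c, hc, fun I => ?_⟩
  suffices H : ∀ τ : (MonomialOrder.lex (σ := Fin n)).syn ×ₗ ρ,
      ∀ x : ρ → MvPolynomial (Fin n) A, (∀ γ, vcoeff γ x ∈ I) →
      ∀ γ, IsLead x γ → termOrder γ = τ →
      ∃ e : ℕ, ∃ y ∈ I • N.restrictScalars A, ∃ s ∈ standardVectors N, c ^ e • x = y + s by
    intro x hx
    by_cases h0 : x = 0
    · exact ⟨0, 0, zero_mem _, 0, zero_mem _, by simp [h0]⟩
    · obtain ⟨γ, hγ⟩ := exists_isLead h0
      exact H _ x hx γ hγ rfl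
  intro τ
  induction τ using WellFoundedLT.induction with
  | ind τ ih =>
    rintro x hx ⟨i, m⟩ hlead rfl
    have key : ∀ x' : ρ → MvPolynomial (Fin n) A, (∀ γ, vcoeff γ x' ∈ I) →
        vcoeff (i, m) x' = 0 → (∀ δ, vcoeff δ x' ≠ 0 → termOrder δ ≤ termOrder (i, m)) →
        ∃ e : ℕ, ∃ y ∈ I • N.restrictScalars A, ∃ s ∈ standardVectors N, c ^ e • x' = y + s := by
      intro x' hx' h0 hle
      by_cases hz : x' = 0
      · exact ⟨0, 0, zero_mem _, 0, zero_mem _, by simp [hz]⟩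
      · obtain ⟨γ, hγ⟩ := exists_isLead hz
        refine ih _ (lt_of_le_of_ne (hle γ hγ.1) fun h => hγ.1 ?_) x' hx' γ hγ rfl
        rw [termOrder_injective h, h0]
    by_cases hmem : (i, m) ∈ leads N
    · obtain ⟨d, m', f, rfl, hf, hfl, c', rfl⟩ := hdiv i m hmem
      set a := vcoeff (i, d + m') x
      set l := vcoeff (i, m') f
      have hyN : monomial d c' • f ∈ N.restrictScalars A := N.smul_mem _ hf
      have h1 : ∀ δ, vcoeff δ (a • monomial d c' • f) ≠ 0 →
          termOrder δ ≤ termOrder (i, d + m') := by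
        intro δ hδ
        rw [map_smul] at hδ
        obtain ⟨p, hp, hpf⟩ := exists_of_vcoeff_monomial_smul (right_ne_zero_of_smul hδ)
        rw [hp]
        exact termOrder_add_le d (hfl.2 _ hpf)
      have hx' := key ((l * c') • x - a • monomial d c' • f) ?_ ?_ ?_
      · obtain ⟨e, y, hy, s, hs, hys⟩ := hx'
        refine ⟨e + 1, y + ((l * c') ^ e * a) • monomial d c' • f,
          add_mem hy (Submodule.smul_mem_smul (I.mul_mem_left _ (hx _)) hyN), s, hs, ?_⟩
        rw [smul_sub, sub_eq_iff_eq_add] at hys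
        rw [pow_succ, mul_smul, hys, mul_smul]
        abel
      · intro γ
        rw [map_sub, map_smul, map_smul]
        exact sub_mem (I.mul_mem_left _ (hx _)) (I.mul_mem_right _ (hx _))
      · rw [map_sub, map_smul, map_smul, vcoeff_monomial_smul_add]
        simp only [smul_eq_mul, a, l]
        ring
      · intro δ hδ
        by_cases h2 : vcoeff δ (a • monomial d c' • f) = 0
        · rw [map_sub, h2, sub_zero, map_smul] at hδ
          exact hlead.2 _ (right_ne_zero_of_smul hδ)
        · exact h1 δ h2
    · set t : ρ → MvPolynomial (Fin n) A := Pi.single i (monomial m (vcoeff (i, m) x))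
      have ht : vcoeff (i, m) t = vcoeff (i, m) x := by simp [t, vcoeff_apply]
      have ht' : ∀ δ, δ ≠ (i, m) → vcoeff δ t = 0 := by
        rintro ⟨j, p⟩ hδ
        by_cases hj : j = i
        · subst hj
          have : m ≠ p := fun h => hδ (by rw [h])
          simp [t, vcoeff_apply, coeff_monomial, this]
        · simp [t, vcoeff_apply, hj]
      have hts : t ∈ standardVectors N := fun γ hγ => ht' γ fun h => hmem (h ▸ hγ)
      have hx' := key (x - t) ?_ ?_ ?_
      · obtain ⟨e, y, hy, s, hs, hys⟩ := hx'
        refine ⟨e, y, hy, s + c ^ e • t, add_mem hs (Submodule.smul_mem _ _ hts), ?_⟩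
        rw [smul_sub, sub_eq_iff_eq_add] at hys
        rw [hys, add_assoc]
      · intro γ
        rw [map_sub]
        by_cases h : γ = (i, m)
        · rw [h, ht, sub_self]; exact zero_mem _
        · rw [ht' γ h, sub_zero]; exact hx γ
      · rw [map_sub, ht, sub_self]
      · intro δ hδ
        by_cases h : δ = (i, m)
        · rw [h]
        · rw [map_sub, ht' δ h, sub_zero] at hδ
          exact hlead.2 _ hδ

end Division

section Kernel

variable {n : ℕ} {ρ σ A F : Type} [CommRing A] [Field F] (ev : A →+* F)

theorem exists_denominator (hev : ∀ x : F, ∃ p q : A, ev q ≠ 0 ∧ x * ev q = ev p)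
    (f : MvPolynomial (Fin n) F) :
    ∃ q : A, ev q ≠ 0 ∧ ∃ g : MvPolynomial (Fin n) A, map ev g = C (ev q) * f := by
  induction f using MvPolynomial.induction_on with
  | C a =>
    obtain ⟨p, q, hq, h⟩ := hev a
    exact ⟨q, hq, C p, by rw [map_C, ← h, mul_comm, C_mul]⟩
  | add f f' hf hf' =>
    obtain ⟨q, hq, g, hg⟩ := hf
    obtain ⟨q', hq', g', hg'⟩ := hf'
    refine ⟨q * q', by simp [hq, hq'], C q' * g + C q * g', ?_⟩
    simp only [map_add, map_mul, map_C, hg, hg']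
    ring
  | mul_X f i hf =>
    obtain ⟨q, hq, g, hg⟩ := hf
    exact ⟨q, hq, g * X i, by rw [map_mul, hg, map_X, mul_assoc]⟩

theorem exists_denominator_vec [Finite σ]
    (hev : ∀ x : F, ∃ p q : A, ev q ≠ 0 ∧ x * ev q = ev p) (v : σ → MvPolynomial (Fin n) F) :
    ∃ q : A, ev q ≠ 0 ∧ ∃ g : σ → MvPolynomial (Fin n) A, ∀ i, map ev (g i) = C (ev q) * v i := by
  classical
  have := Fintype.ofFinite σ
  choose q hq g hg using fun i => exists_denominator ev hev (v i)
  refine ⟨∏ i, q i, by simpa [Finset.prod_ne_zero_iff] using hq,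
    fun i => C (∏ j ∈ Finset.univ.erase i, q j) * g i, fun i => ?_⟩
  rw [map_mul, hg, map_C, ← mul_assoc, ← C_mul, ← map_mul,
    Finset.prod_erase_mul _ _ (Finset.mem_univ i)]

/-- Kernels of polynomial matrices over `A` commute with almost all base changes to fields. -/
theorem exists_kernel_specialization [Finite ρ] [Fintype σ] [IsDomain A]
    (U : Matrix ρ σ (MvPolynomial (Fin n) A)) :
    ∃ c : A, c ≠ 0 ∧ ∀ (F : Type) [Field F] (ev : A →+* F), ev c ≠ 0 →
      (∀ x : F, ∃ p q : A, ev q ≠ 0 ∧ x * ev q = ev p) →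
      ∀ v : σ → MvPolynomial (Fin n) F, (U.map (map ev)).mulVec v = 0 →
      ∃ w : σ → MvPolynomial (Fin n) A, U.mulVec w = 0 ∧ ∃ a : F, a ≠ 0 ∧
        ∀ i, C a * v i = map ev (w i) := by
  have := Fintype.ofFinite ρ
  let _ : LinearOrder ρ := LinearOrder.lift' (Fintype.equivFin ρ) (Equiv.injective _)
  obtain ⟨c, hc, hdiv⟩ := exists_division (LinearMap.range U.mulVecLin)
  refine ⟨c, hc, fun F _ ev hev hfrac v hv => ?_⟩
  obtain ⟨q, hq, V, hV⟩ := exists_denominator_vec ev hfrac v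
  have hmap : ∀ w : σ → MvPolynomial (Fin n) A, ∀ i,
      map ev (U.mulVec w i) = (U.map (map ev)).mulVec (fun j => map ev (w j)) i := by
    intro w i
    simp [Matrix.mulVec, dotProduct]
  have hUV : ∀ i, map ev (U.mulVec V i) = 0 := by
    intro i
    have hV' : (fun j => map ev (V j)) = (C (ev q) : MvPolynomial (Fin n) F) • v :=
      _root_.funext hV
    rw [hmap, hV', Matrix.mulVec_smul, hv]
    simp
  obtain ⟨e, y, hy, s, hs, hys⟩ := hdiv (RingHom.ker ev) (U.mulVec V) (by
    rintro ⟨i, m⟩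
    rw [RingHom.mem_ker, vcoeff_apply, ← coeff_map, hUV, coeff_zero])
  have hyV : ∃ V' : σ → MvPolynomial (Fin n) A, U.mulVec V' = y ∧ ∀ j, map ev (V' j) = 0 := by
    refine Submodule.smul_induction_on hy ?_ ?_
    · rintro a ha _ ⟨z, rfl⟩
      refine ⟨a • z, by rw [Matrix.mulVec_smul]; rfl, fun j => ?_⟩
      rw [Pi.smul_apply, smul_eq_C_mul, map_mul, map_C, (RingHom.mem_ker).1 ha, C_0, zero_mul]
    · rintro x y ⟨a, rfl, ha⟩ ⟨b, rfl, hb⟩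
      exact ⟨a + b, Matrix.mulVec_add .., fun j => by simp [ha, hb]⟩
  obtain ⟨V', rfl, hV'⟩ := hyV
  have hsN : s = 0 := by
    refine eq_zero_of_mem_standardVectors (N := LinearMap.range U.mulVecLin) ?_ hs
    refine ⟨c ^ e • V - V', ?_⟩
    rw [Matrix.mulVecLin_apply, Matrix.mulVec_sub, Matrix.mulVec_smul, hys]
    abel
  refine ⟨c ^ e • V - V', ?_, ev c ^ e * ev q, mul_ne_zero (pow_ne_zero _ hev) hq, fun i => ?_⟩
  · rw [Matrix.mulVec_sub, Matrix.mulVec_smul, hys, hsN]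
    abel
  · rw [Pi.sub_apply, Pi.smul_apply, map_sub, hV', sub_zero, smul_eq_C_mul,
      map_mul (map ev), map_C, hV, map_pow, C_mul, mul_assoc]

end Kernel

section System

/-- A family of partially defined specializations from `S` to rings `T t`, defined on any given
element for almost all `t` and preserving any given exact sequence of finite free modules for
almost all `t`. -/
structure IsSpecialization {S Λ : Type*} [CommRing S] (l : Filter Λ) (T : Λ → Type)
    [∀ t, CommRing (T t)] (E : ∀ t, S → T t → Prop) : Prop where
  zero : ∀ t, E t 0 0
  one : ∀ t, E t 1 1
  add : ∀ t {a b x y}, E t a x → E t b y → E t (a + b) (x + y)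
  mul : ∀ t {a b x y}, E t a x → E t b y → E t (a * b) (x * y)
  unique : ∀ t {a x y}, E t a x → E t a y → x = y
  eventually_exists : ∀ a, ∀ᶠ t in l, ∃ x, E t a x
  exact : ∀ {ρ σ τ : Type} [Fintype ρ] [Fintype σ] [Fintype τ] (U : Matrix ρ σ S)
    (V : Matrix σ τ S), LinearMap.ker U.mulVecLin = LinearMap.range V.mulVecLin →
    ∀ᶠ t in l, ∀ (U' : Matrix ρ σ (T t)) (V' : Matrix σ τ (T t)),
      (∀ i j, E t (U i j) (U' i j)) → (∀ i j, E t (V i j) (V' i j)) →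
      LinearMap.ker U'.mulVecLin = LinearMap.range V'.mulVecLin

theorem exists_mul_eq_of_finite {B S ι : Type*} [CommRing B] [CommRing S] (φ : B →+* S) [Finite ι]
    (hfrac : ∀ a : S, ∃ p g : B, IsUnit (φ g) ∧ a * φ g = φ p) (a : ι → S) :
    ∃ g : B, IsUnit (φ g) ∧ ∃ p : ι → B, ∀ i, a i * φ g = φ (p i) := by
  classical
  have := Fintype.ofFinite ι
  choose p g hg h using fun i => hfrac (a i)
  refine ⟨∏ i, g i, ?_, fun i => p i * ∏ j ∈ Finset.univ.erase i, g j, fun i => ?_⟩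
  · rw [map_prod, IsUnit.prod_univ_iff]
    exact hg
  · rw [map_mul, ← h, mul_assoc, ← map_mul, Finset.mul_prod_erase _ _ (Finset.mem_univ i)]

theorem exists_kernel_matrix {B ρ σ : Type*} [CommRing B] [IsNoetherianRing B] [Fintype σ]
    (U : Matrix ρ σ B) :
    ∃ (p : ℕ) (W : Matrix σ (Fin p) B),
      LinearMap.ker U.mulVecLin = LinearMap.range W.mulVecLin := by
  obtain ⟨p, w, hw⟩ := Submodule.fg_iff_exists_fin_generating_family.1
    (IsNoetherian.noetherian (LinearMap.ker U.mulVecLin))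
  refine ⟨p, Matrix.of fun i j => w j i, ?_⟩
  rw [Matrix.range_mulVecLin, ← hw]
  rfl

theorem ker_mulVecLin_smul {S ρ σ : Type*} [CommRing S] [Fintype σ] {u : S} (hu : IsUnit u)
    (U : Matrix ρ σ S) :
    LinearMap.ker (u • U).mulVecLin = LinearMap.ker U.mulVecLin := by
  ext x
  simp [hu.smul_eq_zero]

theorem range_mulVecLin_smul {S ρ σ : Type*} [CommRing S] [Fintype σ] {u : S} (hu : IsUnit u)
    (U : Matrix ρ σ S) :
    LinearMap.range (u • U).mulVecLin = LinearMap.range U.mulVecLin := by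
  ext x
  constructor
  · rintro ⟨y, rfl⟩
    exact ⟨u • y, by simp⟩
  · rintro ⟨y, rfl⟩
    obtain ⟨u, rfl⟩ := hu
    exact ⟨(↑u⁻¹ : S) • y, by simp [smul_smul]⟩

/-- Inclusions of column spaces are factorizations of matrices. -/
theorem range_mulVecLin_le_iff {S σ τ κ : Type*} [CommRing S] [Fintype τ] [Fintype κ]
    {W : Matrix σ κ S} {V : Matrix σ τ S} :
    LinearMap.range W.mulVecLin ≤ LinearMap.range V.mulVecLin ↔ ∃ Y : Matrix τ κ S, W = V * Y := by
  classical
  constructor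
  · intro h
    have h' : ∀ j, ∃ y, V.mulVec y = W.col j := fun j => by
      obtain ⟨y, hy⟩ := h ⟨Pi.single j 1, rfl⟩
      exact ⟨y, by simpa using hy⟩
    choose y hy using h'
    refine ⟨Matrix.of fun i j => y j i, ?_⟩
    ext i j
    exact (congrFun (hy j) i).symm
  · rintro ⟨Y, rfl⟩ _ ⟨x, rfl⟩
    exact ⟨Y.mulVec x, by simp⟩

theorem range_le_ker_iff {S ρ σ τ : Type*} [CommRing S] [Fintype σ] [Fintype τ]
    {U : Matrix ρ σ S} {V : Matrix σ τ S} :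
    LinearMap.range V.mulVecLin ≤ LinearMap.ker U.mulVecLin ↔ U * V = 0 := by
  rw [LinearMap.range_le_ker_iff, ← Matrix.mulVecLin_mul]
  rw [← Matrix.mulVecLin_zero]
  exact ⟨fun h => Matrix.mulVec_injective (congrArg DFunLike.coe h), fun h => by rw [h]⟩

variable {B S Λ : Type} [CommRing B] [CommRing S] (φ : B →+* S)

/-- The partially defined specialization `φ p / φ g ↦ ψ p / ψ g`. -/
def FracRel {T : Type} [CommRing T] (ψ : B →+* T) (a : S) (x : T) : Prop :=
  ∃ p g : B, IsUnit (φ g) ∧ IsUnit (ψ g) ∧ a * φ g = φ p ∧ x * ψ g = ψ p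

variable {φ} in
theorem FracRel.mul_eq (hφ : Function.Injective φ) {T : Type} [CommRing T] {ψ : B →+* T} {a : S}
    {x : T} (h : FracRel φ ψ a x) {p g : B} (ha : a * φ g = φ p) : x * ψ g = ψ p := by
  obtain ⟨q, r, hr, hr', hq, hx⟩ := h
  have h1 : q * g = p * r := hφ (by rw [map_mul, map_mul, ← hq, ← ha]; ring)
  refine hr'.mul_right_cancel ?_
  rw [← map_mul, ← h1, map_mul, ← hx]
  ring

theorem isSpecialization_fracRel {Λ : Type*} [IsNoetherianRing B] (hφ : Function.Injective φ)
    (hfrac : ∀ a : S, ∃ p g : B, IsUnit (φ g) ∧ a * φ g = φ p)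
    (l : Filter Λ) (T : Λ → Type) [∀ t, CommRing (T t)] (ψ : ∀ t, B →+* T t)
    (hunit : ∀ g, IsUnit (φ g) → ∀ᶠ t in l, IsUnit (ψ t g))
    (hker : ∀ {ρ σ : Type} [Fintype ρ] [Fintype σ] (U : Matrix ρ σ B), ∀ᶠ t in l,
      ∀ v : σ → T t, (U.map (ψ t)).mulVec v = 0 →
        ∃ w : σ → B, U.mulVec w = 0 ∧ ∃ a : T t, IsUnit a ∧ ∀ i, a * v i = ψ t (w i)) :
    IsSpecialization l T fun t => FracRel φ (ψ t) where
  zero t := ⟨0, 1, by simp, by simp, by simp, by simp⟩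
  one t := ⟨1, 1, by simp, by simp, by simp, by simp⟩
  add t a b x y := by
    rintro ⟨p, g, h1, h2, h3, h4⟩ ⟨p', g', h1', h2', h3', h4'⟩
    refine ⟨p * g' + p' * g, g * g', by simp [h1, h1'], by simp [h2, h2'], ?_, ?_⟩
    · simp only [map_mul, map_add, ← h3, ← h3']; ring
    · simp only [map_mul, map_add, ← h4, ← h4']; ring
  mul t a b x y := by
    rintro ⟨p, g, h1, h2, h3, h4⟩ ⟨p', g', h1', h2', h3', h4'⟩
    refine ⟨p * p', g * g', by simp [h1, h1'], by simp [h2, h2'], ?_, ?_⟩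
    · simp only [map_mul, ← h3, ← h3']; ring
    · simp only [map_mul, ← h4, ← h4']; ring
  unique t a x y hx hy := by
    obtain ⟨p, g, h1, h2, h3, h4⟩ := hx
    exact h2.mul_right_cancel (h4.trans (hy.mul_eq hφ h3).symm)
  eventually_exists a := by
    obtain ⟨p, g, hg, h⟩ := hfrac a
    filter_upwards [hunit g hg] with t ht
    exact ⟨ψ t p * ↑(ht.unit⁻¹), p, g, hg, ht, h, by simp [mul_assoc]⟩
  exact {ρ σ τ} _ _ _ U V hUV := by
    obtain ⟨g, hg, U₀, hU⟩ := exists_mul_eq_of_finite φ hfrac fun i : ρ × σ => U i.1 i.2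
    obtain ⟨h, hh, V₀, hV⟩ := exists_mul_eq_of_finite φ hfrac fun i : σ × τ => V i.1 i.2
    set U₁ : Matrix ρ σ B := Matrix.of fun i j => U₀ (i, j)
    set V₁ : Matrix σ τ B := Matrix.of fun i j => V₀ (i, j)
    have hU₁ : U₁.map φ = φ g • U := by ext i j; simp [U₁, ← hU, mul_comm]
    have hV₁ : V₁.map φ = φ h • V := by ext i j; simp [V₁, ← hV, mul_comm]
    have hUV₁ : LinearMap.ker (U₁.map φ).mulVecLin = LinearMap.range (V₁.map φ).mulVecLin := by
      rw [hU₁, hV₁, ker_mulVecLin_smul hg, range_mulVecLin_smul hh, hUV]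
    have hmapinj : ∀ {α β : Type} {X Y : Matrix α β B}, X.map φ = Y.map φ → X = Y :=
      fun {α β X Y} hXY => by
        ext i j
        exact hφ (congrFun (congrFun hXY i) j)
    have hzero : U₁ * V₁ = 0 := by
      refine hmapinj ?_
      rw [Matrix.map_mul, range_le_ker_iff.1 hUV₁.ge, Matrix.map_zero _ (map_zero φ)]
    obtain ⟨p, W, hW⟩ := exists_kernel_matrix U₁
    have hWV : LinearMap.range (W.map φ).mulVecLin ≤ LinearMap.range (V₁.map φ).mulVecLin := by
      rw [← hUV₁, range_le_ker_iff, ← Matrix.map_mul, range_le_ker_iff.1 hW.ge,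
        Matrix.map_zero _ (map_zero φ)]
    obtain ⟨Y, hY⟩ := range_mulVecLin_le_iff.1 hWV
    obtain ⟨f, hf, Y₀, hY₀⟩ := exists_mul_eq_of_finite φ hfrac fun i : τ × Fin p => Y i.1 i.2
    set Y₁ : Matrix τ (Fin p) B := Matrix.of fun i j => Y₀ (i, j)
    have hY₁ : Y₁.map φ = φ f • Y := by ext i j; simp [Y₁, ← hY₀, mul_comm]
    have hWY : f • W = V₁ * Y₁ := by
      refine hmapinj ?_
      rw [Matrix.map_mul, hY₁, Matrix.mul_smul, ← hY]
      ext i j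
      simp
    filter_upwards [hunit g hg, hunit h hh, hunit f hf, hker U₁] with t htg hth htf htk U' V' hU' hV'
    have hU'₁ : U₁.map (ψ t) = ψ t g • U' := by
      ext i j
      have := (hU' i j).mul_eq hφ (hU (i, j))
      simp [U₁, ← this, mul_comm]
    have hV'₁ : V₁.map (ψ t) = ψ t h • V' := by
      ext i j
      have := (hV' i j).mul_eq hφ (hV (i, j))
      simp [V₁, ← this, mul_comm]
    rw [← ker_mulVecLin_smul htg, ← range_mulVecLin_smul hth, ← hU'₁, ← hV'₁]
    refine le_antisymm ?_ ?_
    · intro v hv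
      obtain ⟨w, hw, a, ⟨a, rfl⟩, hav⟩ := htk v hv
      obtain ⟨z, rfl⟩ : w ∈ LinearMap.range W.mulVecLin := hW ▸ hw
      have hle : LinearMap.range (W.map (ψ t)).mulVecLin ≤
          LinearMap.range (V₁.map (ψ t)).mulVecLin := by
        rw [← range_mulVecLin_smul htf, range_mulVecLin_le_iff]
        refine ⟨Y₁.map (ψ t), ?_⟩
        rw [← Matrix.map_mul, ← hWY]
        ext i j
        simp
      refine hle ⟨(↑a⁻¹ : T t) • fun j => ψ t (z j), ?_⟩
      rw [map_smul]
      funext i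
      have h1 : (W.map (ψ t)).mulVecLin (fun j => ψ t (z j)) i = ψ t (W.mulVecLin z i) := by
        simp [Matrix.mulVec, dotProduct]
      rw [Pi.smul_apply, h1, ← hav, smul_eq_mul, Units.inv_mul_cancel_left]
    · rw [range_le_ker_iff, ← Matrix.map_mul, hzero, Matrix.map_zero _ (map_zero _)]

end System

section PairHomology

variable {R X Y Z X' Y' Z' : Type*} [CommRing R] [AddCommGroup X] [Module R X] [AddCommGroup Y]
  [Module R Y] [AddCommGroup Z] [Module R Z] [AddCommGroup X'] [Module R X'] [AddCommGroup Y']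
  [Module R Y'] [AddCommGroup Z'] [Module R Z']

/-- The homology at `Y` of a pair of maps `X → Y → Z`. -/
abbrev PairHomology (f : X →ₗ[R] Y) (g : Y →ₗ[R] Z) :=
  LinearMap.ker g ⧸ (LinearMap.range f).submoduleOf (LinearMap.ker g)

theorem nonempty_pairHomology_equiv {f : X →ₗ[R] Y} {g : Y →ₗ[R] Z} {Q : Type*} [AddCommGroup Q]
    [Module R Q] (φ : Q →ₗ[R] Y) {N : Submodule R Q}
    (hφ : ∀ y, g y = 0 → ∃ q, φ q - y ∈ LinearMap.range f)
    (hg : ∀ q, g (φ q) = 0) (hN : ∀ q, φ q ∈ LinearMap.range f ↔ q ∈ N) :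
    Nonempty (PairHomology f g ≃ₗ[R] (Q ⧸ N)) := by
  let ψ : Q →ₗ[R] PairHomology f g := Submodule.mkQ _ ∘ₗ φ.codRestrict _ hg
  have hψ : Function.Surjective ψ := by
    intro y
    obtain ⟨⟨y, hy⟩, rfl⟩ := Submodule.mkQ_surjective _ y
    obtain ⟨q, hq⟩ := hφ y hy
    exact ⟨q, (Submodule.Quotient.eq _).2 hq⟩
  have hker : LinearMap.ker ψ = N := by
    ext q
    rw [← hN, LinearMap.mem_ker]
    exact Submodule.Quotient.mk_eq_zero _
  exact ⟨(ψ.quotKerEquivOfSurjective hψ).symm.trans (Submodule.quotEquivOfEq _ _ hker)⟩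

theorem nonempty_pairHomology_congr {f : X →ₗ[R] Y} {g : Y →ₗ[R] Z} {f' : X' →ₗ[R] Y'}
    {g' : Y' →ₗ[R] Z'} (eX : X ≃ₗ[R] X') (eY : Y ≃ₗ[R] Y') (eZ : Z ≃ₗ[R] Z')
    (hf : ∀ x, eY (f x) = f' (eX x)) (hg : ∀ y, eZ (g y) = g' (eY y)) :
    Nonempty (PairHomology f g ≃ₗ[R] PairHomology f' g') := by
  have hker : (LinearMap.ker g).map (eY : Y →ₗ[R] Y') = LinearMap.ker g' := by
    ext y
    obtain ⟨y, rfl⟩ := eY.surjective y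
    simp [← hg]
  refine ⟨Submodule.Quotient.equiv _ _ ((eY.submoduleMap _).trans (LinearEquiv.ofEq _ _ hker)) ?_⟩
  ext ⟨y, hy⟩
  obtain ⟨y, rfl⟩ := eY.surjective y
  simp only [Submodule.mem_map, Submodule.submoduleOf, Submodule.mem_comap,
    Submodule.subtype_apply]
  constructor
  · rintro ⟨⟨z, hz⟩, ⟨x, hx⟩, h⟩
    refine ⟨eX x, ?_⟩
    rw [← hf]
    have h' := congrArg Subtype.val h
    change eY z = eY y at h'
    rw [hx, ← h']
  · rintro ⟨x, hx⟩
    obtain ⟨x, rfl⟩ := eX.surjective x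
    rw [← hf] at hx
    have hx' : f x = y := eY.injective hx
    have hy' : g y = 0 := eZ.injective (by rw [hg, map_zero]; exact hy)
    exact ⟨⟨y, hy'⟩, ⟨x, hx'⟩, rfl⟩

theorem nonempty_pairHomology_equiv_of_lift {Fa Fb Fc Ca Cb G J : Type*} [AddCommGroup Fa]
    [AddCommGroup Fb] [AddCommGroup Fc] [AddCommGroup Ca] [AddCommGroup Cb] [AddCommGroup G]
    [AddCommGroup J] [Module R Fa] [Module R Fb] [Module R Fc] [Module R Ca] [Module R Cb]
    [Module R G] [Module R J] {f : X →ₗ[R] Y} {g : Y →ₗ[R] Z} {πX : Fc →ₗ[R] X} {πY : Fb →ₗ[R] Y}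
    {πZ : Fa →ₗ[R] Z} {f' : Fc →ₗ[R] Fb} {g' : Fb →ₗ[R] Fa} {cZ : Ca →ₗ[R] Fa} {cY : Cb →ₗ[R] Fb}
    {γ : G →ₗ[R] Fb} {j : J →ₗ[R] G} (hX : Function.Surjective πX) (hY : Function.Surjective πY)
    (hf : ∀ x, πY (f' x) = f (πX x)) (hg : ∀ y, πZ (g' y) = g (πY y))
    (hcY : LinearMap.ker πY = LinearMap.range cY) (hcZ : LinearMap.ker πZ = LinearMap.range cZ)
    (hγ : ∀ y, y ∈ LinearMap.range γ ↔ ∃ z, g' y + cZ z = 0)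
    (hj : ∀ q, q ∈ LinearMap.range j ↔ ∃ z x, γ q + (cY z + f' x) = 0) :
    Nonempty (PairHomology f g ≃ₗ[R] (G ⧸ LinearMap.range j)) := by
  have hγ' : ∀ y, y ∈ LinearMap.range γ ↔ g (πY y) = 0 := by
    intro y
    rw [hγ, ← hg, ← LinearMap.mem_ker, hcZ]
    constructor
    · rintro ⟨z, hz⟩
      exact ⟨-z, by rw [map_neg, neg_eq_of_add_eq_zero_left hz]⟩
    · rintro ⟨z, hz⟩
      exact ⟨-z, by rw [map_neg, hz, add_neg_cancel]⟩
  refine nonempty_pairHomology_equiv (πY ∘ₗ γ) (fun y hy => ?_)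
    (fun q => (hγ' _).1 ⟨q, rfl⟩) (fun q => ?_)
  · obtain ⟨y, rfl⟩ := hY y
    obtain ⟨q, rfl⟩ := (hγ' y).2 hy
    exact ⟨q, 0, by simp⟩
  · rw [hj]
    constructor
    · rintro ⟨x, hx⟩
      obtain ⟨x, rfl⟩ := hX x
      have : γ q - f' x ∈ LinearMap.ker πY := by
        rw [LinearMap.mem_ker, map_sub, hf, hx]
        exact sub_self _
      rw [hcY] at this
      obtain ⟨z, hz⟩ := this
      exact ⟨-z, -x, by rw [map_neg, map_neg, hz]; abel⟩
    · rintro ⟨z, x, h⟩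
      refine ⟨-πX x, ?_⟩
      have hz : πY (cY z) = 0 := by
        rw [← LinearMap.mem_ker, hcY]
        exact ⟨z, rfl⟩
      have h' := congrArg πY h
      rw [map_add, map_add, hz, zero_add, map_zero, hf] at h'
      rw [map_neg, LinearMap.comp_apply, neg_eq_of_add_eq_zero_left h']

end PairHomology
section Cokernel

variable {R : Type} [CommRing R]

/-- The action of a matrix with coefficients in `R` on vectors with entries in an `R`-module. -/
def act {a b : Type*} [Fintype b] (U : Matrix a b R) (N : Type*) [AddCommGroup N] [Module R N] :
    (b → N) →ₗ[R] (a → N) :=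
  LinearMap.pi fun i => ∑ j, U i j • LinearMap.proj j

theorem act_apply {a b : Type*} [Fintype b] (U : Matrix a b R) {N : Type*} [AddCommGroup N]
    [Module R N] (x : b → N) (i : a) : act U N x i = ∑ j, U i j • x j := by
  simp [act]

open Matrix Kronecker

theorem range_toRows₁ {σ τ ρ κ : Type*} [Fintype σ] [Fintype τ] [Fintype κ] {A : Matrix ρ σ R}
    {B : Matrix ρ τ R} {W : Matrix (σ ⊕ τ) κ R}
    (h : LinearMap.ker (fromCols A B).mulVecLin = LinearMap.range W.mulVecLin) (y : σ → R) :
    y ∈ LinearMap.range W.toRows₁.mulVecLin ↔ ∃ z, A.mulVecLin y + B.mulVecLin z = 0 := by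
  constructor
  · rintro ⟨x, rfl⟩
    refine ⟨W.toRows₂.mulVecLin x, ?_⟩
    have hx : W.mulVecLin x ∈ LinearMap.ker (fromCols A B).mulVecLin := h ▸ ⟨x, rfl⟩
    rw [← fromRows_toRows W, LinearMap.mem_ker] at hx
    simp only [mulVecLin_apply, fromRows_mulVec, fromCols_mulVec_sumElim] at hx
    exact hx
  · rintro ⟨z, hz⟩
    have hx : Sum.elim y z ∈ LinearMap.ker (fromCols A B).mulVecLin := by
      simpa [fromCols_mulVec] using hz
    rw [h] at hx
    obtain ⟨x, hx⟩ := hx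
    refine ⟨x, ?_⟩
    funext i
    exact congrFun hx (Sum.inl i)

/-- The map on families induced by a map from a free module, with both indices combined. -/
def piUncurry (a : Type*) {r : Type*} {N : Type*} [AddCommGroup N] [Module R N]
    (π : (r → R) →ₗ[R] N) : (a × r → R) →ₗ[R] (a → N) :=
  LinearMap.pi fun i => π ∘ₗ LinearMap.funLeft R R (Prod.mk i)

theorem piUncurry_surjective (a : Type*) {r : Type*} {N : Type*} [AddCommGroup N] [Module R N]
    {π : (r → R) →ₗ[R] N} (hπ : Function.Surjective π) : Function.Surjective (piUncurry a π) := by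
  intro x
  choose y hy using fun i => hπ (x i)
  exact ⟨fun p => y p.1 p.2, funext hy⟩

theorem ker_piUncurry {a r s : Type*} [Fintype a] [DecidableEq a] [Fintype s] {N : Type*}
    [AddCommGroup N] [Module R N] {π : (r → R) →ₗ[R] N} {C : Matrix r s R}
    (hC : LinearMap.ker π = LinearMap.range C.mulVecLin) :
    LinearMap.ker (piUncurry a π) =
      LinearMap.range ((1 : Matrix a a R) ⊗ₖ C).mulVecLin := by
  have happ : ∀ z i ρ, ((1 : Matrix a a R) ⊗ₖ C).mulVecLin z (i, ρ) =
      C.mulVecLin (fun σ => z (i, σ)) ρ := by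
    intro z i ρ
    simp [mulVec, dotProduct, Fintype.sum_prod_type, one_apply]
  ext y
  constructor
  · intro hy
    have h : ∀ i, ∃ z, C.mulVecLin z = fun ρ => y (i, ρ) := fun i => by
      have : (fun ρ => y (i, ρ)) ∈ LinearMap.ker π := congrFun hy i
      rwa [hC] at this
    choose z hz using h
    refine ⟨fun p => z p.1 p.2, ?_⟩
    funext ⟨i, ρ⟩
    rw [happ]
    exact congrFun (hz i) ρ
  · rintro ⟨z, rfl⟩
    funext i
    change (fun ρ => ((1 : Matrix a a R) ⊗ₖ C).mulVecLin z (i, ρ)) ∈ LinearMap.ker π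
    rw [hC]
    exact ⟨fun σ => z (i, σ), funext fun ρ => (happ z i ρ).symm⟩

theorem piUncurry_kronecker {a b r : Type*} [Fintype b] [Fintype r] [DecidableEq r] {N : Type*}
    [AddCommGroup N] [Module R N] (π : (r → R) →ₗ[R] N) (U : Matrix a b R) (y : b × r → R) :
    piUncurry a π ((U ⊗ₖ (1 : Matrix r r R)).mulVecLin y) = act U N (piUncurry b π y) := by
  funext i
  rw [act_apply]
  change π (fun ρ => _) = ∑ j, U i j • π (fun ρ => y (j, ρ))
  simp only [← map_smul, ← map_sum]
  congr 1
  funext ρ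
  simp [mulVec, dotProduct, Fintype.sum_prod_type, one_apply]

/-- The homology of `Nᶜ → Nᵇ → Nᵃ` for `N` the cokernel of `C` is presented by `J`. -/
theorem nonempty_pairHomology_act_equiv {a b c r s g h : Type*} [Fintype a] [Fintype b] [Fintype c]
    [Fintype r] [Fintype s] [Fintype g] [Fintype h] [DecidableEq a] [DecidableEq b] [DecidableEq r]
    {N : Type*} [AddCommGroup N] [Module R N] {π : (r → R) →ₗ[R] N} {C : Matrix r s R}
    (hπ : Function.Surjective π) (hC : LinearMap.ker π = LinearMap.range C.mulVecLin)
    {U : Matrix a b R} {V : Matrix b c R} {G : Matrix (b × r ⊕ a × s) g R}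
    {J : Matrix (g ⊕ (b × s ⊕ c × r)) h R}
    (hG : LinearMap.ker (fromCols (U ⊗ₖ (1 : Matrix r r R)) ((1 : Matrix a a R) ⊗ₖ C)).mulVecLin =
      LinearMap.range G.mulVecLin)
    (hJ : LinearMap.ker (fromCols G.toRows₁ (fromCols ((1 : Matrix b b R) ⊗ₖ C)
      (V ⊗ₖ (1 : Matrix r r R)))).mulVecLin = LinearMap.range J.mulVecLin) :
    Nonempty (PairHomology (act V N) (act U N) ≃ₗ[R] ((g → R) ⧸ LinearMap.range
      J.toRows₁.mulVecLin)) := by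
  refine nonempty_pairHomology_equiv_of_lift (γ := G.toRows₁.mulVecLin)
    (piUncurry_surjective c hπ) (piUncurry_surjective b hπ) (piUncurry_kronecker π V)
    (piUncurry_kronecker π U) (ker_piUncurry hC) (ker_piUncurry hC) (range_toRows₁ hG) fun q => ?_
  rw [range_toRows₁ hJ]
  constructor
  · rintro ⟨z, hz⟩
    refine ⟨fun i => z (Sum.inl i), fun i => z (Sum.inr i), ?_⟩
    rw [← hz, ← Sum.elim_comp_inl_inr z]
    simp [fromCols_mulVec, Function.comp_def]
  · rintro ⟨z, x, h⟩
    exact ⟨Sum.elim z x, by simpa [fromCols_mulVec] using h⟩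

theorem exists_matrix_lift {r r' : Type*} [Fintype r] [DecidableEq r] {N : Type*} [AddCommGroup N]
    [Module R N] (π : (r' → R) →ₗ[R] N) (hπ : Function.Surjective π) (f : (r → R) →ₗ[R] N) :
    ∃ W : Matrix r' r R, π ∘ₗ W.mulVecLin = f := by
  obtain ⟨w, hw⟩ := Module.projective_lifting_property π f hπ
  exact ⟨LinearMap.toMatrix' w, by rwa [← Matrix.toLin'_apply', Matrix.toLin'_toMatrix']⟩

theorem exists_matrices_of_equiv {r s r' s' : ℕ} {J : Matrix (Fin r) (Fin s) R}
    {E : Matrix (Fin r') (Fin s') R} (e : MatCoker J ≃ₗ[R] MatCoker E) :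
    ∃ (W : Matrix (Fin r') (Fin r) R) (W' : Matrix (Fin r) (Fin r') R)
      (Y : Matrix (Fin s') (Fin s) R) (Y' : Matrix (Fin s) (Fin s') R)
      (Z : Matrix (Fin s) (Fin r) R) (Z' : Matrix (Fin s') (Fin r') R),
      W * J = E * Y ∧ W' * E = J * Y' ∧ W' * W = 1 + J * Z ∧ W * W' = 1 + E * Z' := by
  obtain ⟨W, hW⟩ := exists_matrix_lift _ (Submodule.mkQ_surjective
    (LinearMap.range E.mulVecLin)) (e.toLinearMap ∘ₗ Submodule.mkQ _)
  obtain ⟨W', hW'⟩ := exists_matrix_lift _ (Submodule.mkQ_surjective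
    (LinearMap.range J.mulVecLin)) (e.symm.toLinearMap ∘ₗ Submodule.mkQ _)
  replace hW : ∀ x, Submodule.mkQ (LinearMap.range E.mulVecLin) (W.mulVecLin x) =
    e (Submodule.mkQ _ x) := fun x => LinearMap.congr_fun hW x
  replace hW' : ∀ x, Submodule.mkQ (LinearMap.range J.mulVecLin) (W'.mulVecLin x) =
    e.symm (Submodule.mkQ _ x) := fun x => LinearMap.congr_fun hW' x
  have h1 : LinearMap.range (W * J).mulVecLin ≤ LinearMap.range E.mulVecLin := by
    rintro _ ⟨x, rfl⟩
    rw [Matrix.mulVecLin_mul, LinearMap.comp_apply, ← Submodule.ker_mkQ (LinearMap.range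
      E.mulVecLin), LinearMap.mem_ker, hW, (LinearMap.mem_ker.1 (by rw [Submodule.ker_mkQ]; exact ⟨x, rfl⟩) : Submodule.mkQ (LinearMap.range
      J.mulVecLin) (J.mulVecLin x) = 0), map_zero]
  have h2 : LinearMap.range (W' * E).mulVecLin ≤ LinearMap.range J.mulVecLin := by
    rintro _ ⟨x, rfl⟩
    rw [Matrix.mulVecLin_mul, LinearMap.comp_apply, ← Submodule.ker_mkQ (LinearMap.range
      J.mulVecLin), LinearMap.mem_ker, hW', (LinearMap.mem_ker.1 (by rw [Submodule.ker_mkQ]; exact ⟨x, rfl⟩) : Submodule.mkQ (LinearMap.range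
      E.mulVecLin) (E.mulVecLin x) = 0), map_zero]
  have h3 : LinearMap.range (W' * W - 1).mulVecLin ≤ LinearMap.range J.mulVecLin := by
    rintro _ ⟨x, rfl⟩
    rw [← Submodule.ker_mkQ (LinearMap.range J.mulVecLin), LinearMap.mem_ker, mulVecLin_apply,
      sub_mulVec, one_mulVec, ← mulVec_mulVec, map_sub]
    have := hW' (W.mulVecLin x)
    rw [hW, e.symm_apply_apply] at this
    exact sub_eq_zero.2 this
  have h4 : LinearMap.range (W * W' - 1).mulVecLin ≤ LinearMap.range E.mulVecLin := by
    rintro _ ⟨x, rfl⟩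
    rw [← Submodule.ker_mkQ (LinearMap.range E.mulVecLin), LinearMap.mem_ker, mulVecLin_apply,
      sub_mulVec, one_mulVec, ← mulVec_mulVec, map_sub]
    have := hW (W'.mulVecLin x)
    rw [hW', e.apply_symm_apply] at this
    exact sub_eq_zero.2 this
  obtain ⟨Y, hY⟩ := range_mulVecLin_le_iff.1 h1
  obtain ⟨Y', hY'⟩ := range_mulVecLin_le_iff.1 h2
  obtain ⟨Z, hZ⟩ := range_mulVecLin_le_iff.1 h3
  obtain ⟨Z', hZ'⟩ := range_mulVecLin_le_iff.1 h4
  exact ⟨W, W', Y, Y', Z, Z', hY, hY', by rw [← hZ, add_sub_cancel], by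
    rw [← hZ', add_sub_cancel]⟩

theorem nonempty_matCoker_equiv {r s r' s' : ℕ} {J : Matrix (Fin r) (Fin s) R}
    {E : Matrix (Fin r') (Fin s') R} {W : Matrix (Fin r') (Fin r) R}
    {W' : Matrix (Fin r) (Fin r') R} {Y : Matrix (Fin s') (Fin s) R}
    {Y' : Matrix (Fin s) (Fin s') R} {Z : Matrix (Fin s) (Fin r) R}
    {Z' : Matrix (Fin s') (Fin r') R} (h1 : W * J = E * Y) (h2 : W' * E = J * Y')
    (h3 : W' * W = 1 + J * Z) (h4 : W * W' = 1 + E * Z') :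
    Nonempty (MatCoker J ≃ₗ[R] MatCoker E) := by
  refine ⟨LinearEquiv.ofLinearMap (cokerMap W (comm_le h1)) (cokerMap W' (comm_le h2)) ?_ ?_⟩
  · refine Submodule.linearMap_qext _ (LinearMap.ext fun x => ?_)
    refine (Submodule.Quotient.eq _).2 ⟨Z'.mulVec x, ?_⟩
    simp [mulVec_mulVec, h4, add_mulVec]
  · refine Submodule.linearMap_qext _ (LinearMap.ext fun x => ?_)
    refine (Submodule.Quotient.eq _).2 ⟨Z.mulVec x, ?_⟩
    simp [mulVec_mulVec, h3, add_mulVec]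

end Cokernel

section Core

open Matrix Kronecker

/-- Entrywise relation between matrices. -/
def Entrywise {S T ρ σ : Type*} (E : S → T → Prop) (A : Matrix ρ σ S) (B : Matrix ρ σ T) : Prop :=
  ∀ i j, E (A i j) (B i j)

variable {S Λ : Type*} [CommRing S] {l : Filter Λ} {T : Λ → Type} [∀ t, CommRing (T t)]
  {E : ∀ t, S → T t → Prop}

namespace IsSpecialization

variable (hE : IsSpecialization l T E)

include hE

theorem sum {t : Λ} {ι : Type*} (s : Finset ι) {f : ι → S} {g : ι → T t}
    (h : ∀ i, E t (f i) (g i)) : E t (∑ i ∈ s, f i) (∑ i ∈ s, g i) := by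
  classical
  induction s using Finset.induction_on with
  | empty => simpa using hE.zero t
  | insert i s hi ih =>
    rw [Finset.sum_insert hi, Finset.sum_insert hi]
    exact hE.add t (h i) ih

theorem matrix_mul {t : Λ} {ρ σ τ : Type*} [Fintype σ] {A : Matrix ρ σ S} {B : Matrix σ τ S}
    {A' : Matrix ρ σ (T t)} {B' : Matrix σ τ (T t)} (hA : Entrywise (E t) A A')
    (hB : Entrywise (E t) B B') : Entrywise (E t) (A * B) (A' * B') :=
  fun i j => hE.sum _ fun q => hE.mul t (hA i q) (hB q j)

theorem matrix_one {t : Λ} {ρ : Type*} [DecidableEq ρ] :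
    Entrywise (E t) (1 : Matrix ρ ρ S) (1 : Matrix ρ ρ (T t)) := by
  intro i j
  by_cases h : i = j
  · rw [h, one_apply_eq, one_apply_eq]
    exact hE.one t
  · simpa [h] using hE.zero t

theorem matrix_zero {t : Λ} {ρ σ : Type*} :
    Entrywise (E t) (0 : Matrix ρ σ S) (0 : Matrix ρ σ (T t)) :=
  fun _ _ => hE.zero t

theorem matrix_kronecker {t : Λ} {ρ σ τ κ : Type*} {A : Matrix ρ σ S} {B : Matrix τ κ S}
    {A' : Matrix ρ σ (T t)} {B' : Matrix τ κ (T t)} (hA : Entrywise (E t) A A')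
    (hB : Entrywise (E t) B B') : Entrywise (E t) (A ⊗ₖ B) (A' ⊗ₖ B') :=
  fun i j => hE.mul t (hA i.1 j.1) (hB i.2 j.2)

theorem matrix_unique {t : Λ} {ρ σ : Type*} {A : Matrix ρ σ S} {B B' : Matrix ρ σ (T t)}
    (hB : Entrywise (E t) A B) (hB' : Entrywise (E t) A B') : B = B' :=
  Matrix.ext fun i j => hE.unique t (hB i j) (hB' i j)

theorem eventually_exists_matrix {ρ σ : Type*} [Finite ρ] [Finite σ] (A : Matrix ρ σ S) :
    ∀ᶠ t in l, ∃ B : Matrix ρ σ (T t), Entrywise (E t) A B := by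
  have : ∀ᶠ t in l, ∀ i j, ∃ x, E t (A i j) x :=
    Filter.eventually_all.2 fun i => Filter.eventually_all.2 fun j => hE.eventually_exists _
  filter_upwards [this] with t ht
  choose B hB using ht
  exact ⟨B, hB⟩

end IsSpecialization

theorem Entrywise.fromCols {S T ρ σ τ : Type*} {E : S → T → Prop} {A : Matrix ρ σ S}
    {B : Matrix ρ τ S} {A' : Matrix ρ σ T} {B' : Matrix ρ τ T} (hA : Entrywise E A A')
    (hB : Entrywise E B B') : Entrywise E (fromCols A B) (Matrix.fromCols A' B') := by
  rintro i (j | j)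
  · exact hA i j
  · exact hB i j

theorem Entrywise.toRows₁ {S T ρ σ τ : Type*} {E : S → T → Prop} {A : Matrix (ρ ⊕ τ) σ S}
    {A' : Matrix (ρ ⊕ τ) σ T} (hA : Entrywise E A A') : Entrywise E A.toRows₁ A'.toRows₁ :=
  fun i j => hA (Sum.inl i) j

theorem Entrywise.transpose {S T ρ σ : Type*} {E : S → T → Prop} {A : Matrix ρ σ S}
    {A' : Matrix ρ σ T} (hA : Entrywise E A A') : Entrywise E A.transpose A'.transpose :=
  fun i j => hA j i

end Core

section CoreTheorem

open Matrix Kronecker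

variable {S : Type} {Λ : Type*} [CommRing S] {l : Filter Λ} {T : Λ → Type} [∀ t, CommRing (T t)]
  {E : ∀ t, S → T t → Prop}

theorem IsSpecialization.eventually_matCoker_equiv (hE : IsSpecialization l T E) {r s r' s' : ℕ}
    {J : Matrix (Fin r) (Fin s) S} {D : Matrix (Fin r') (Fin s') S}
    (e : MatCoker J ≃ₗ[S] MatCoker D) :
    ∀ᶠ t in l, ∀ J' D', Entrywise (E t) J J' → Entrywise (E t) D D' →
      Nonempty (MatCoker J' ≃ₗ[T t] MatCoker D') := by
  obtain ⟨W, W', Y, Y', Z, Z', h1, h2, h3, h4⟩ := exists_matrices_of_equiv e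
  filter_upwards [hE.eventually_exists_matrix W, hE.eventually_exists_matrix W',
    hE.eventually_exists_matrix Y, hE.eventually_exists_matrix Y', hE.eventually_exists_matrix Z,
    hE.eventually_exists_matrix Z'] with t ⟨w, hw⟩ ⟨w', hw'⟩ ⟨y, hy⟩ ⟨y', hy'⟩ ⟨z, hz⟩ ⟨z', hz'⟩
    J' D' hJ hD
  have hadd : ∀ {a : ℕ} {A B : Matrix (Fin a) (Fin a) S} {A' B' : Matrix (Fin a) (Fin a) (T t)},
      Entrywise (E t) A A' → Entrywise (E t) B B' → Entrywise (E t) (A + B) (A' + B') :=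
    fun hA hB i j => hE.add t (hA i j) (hB i j)
  refine nonempty_matCoker_equiv (W := w) (W' := w') (Y := y) (Y' := y') (Z := z) (Z' := z')
    ?_ ?_ ?_ ?_
  · exact hE.matrix_unique (hE.matrix_mul hw hJ) (h1 ▸ hE.matrix_mul hD hy)
  · exact hE.matrix_unique (hE.matrix_mul hw' hD) (h2 ▸ hE.matrix_mul hJ hy')
  · exact hE.matrix_unique (hE.matrix_mul hw' hw)
      (h3 ▸ hadd hE.matrix_one (hE.matrix_mul hJ hz))
  · exact hE.matrix_unique (hE.matrix_mul hw hw')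
      (h4 ▸ hadd hE.matrix_one (hE.matrix_mul hD hz'))

theorem IsSpecialization.eventually_pairHomology_equiv [IsNoetherianRing S]
    (hE : IsSpecialization l T E) {a b c : Type} [Fintype a] [Fintype b] [Fintype c]
    [DecidableEq a] [DecidableEq b] {r s r' s' : ℕ} (U : Matrix a b S) (V : Matrix b c S)
    {N : Type} [AddCommGroup N] [Module S N] (pN : Present S r s N)
    {D : Matrix (Fin r') (Fin s') S}
    (h : Nonempty (PairHomology (act V N) (act U N) ≃ₗ[S] MatCoker D)) :
    ∀ᶠ t in l, ∀ U' V' C' D', Entrywise (E t) U U' → Entrywise (E t) V V' →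
      Entrywise (E t) pN.A C' → Entrywise (E t) D D' →
      Nonempty (PairHomology (act V' (MatCoker C')) (act U' (MatCoker C')) ≃ₗ[T t]
        MatCoker D') := by
  obtain ⟨g, G, hG⟩ := exists_kernel_matrix
    (fromCols (U ⊗ₖ (1 : Matrix (Fin r) (Fin r) S)) ((1 : Matrix a a S) ⊗ₖ pN.A))
  obtain ⟨j, J, hJ⟩ := exists_kernel_matrix
    (fromCols G.toRows₁ (fromCols ((1 : Matrix b b S) ⊗ₖ pN.A) (V ⊗ₖ (1 : Matrix (Fin r) (Fin r) S))))
  obtain ⟨e⟩ := h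
  obtain ⟨e'⟩ := nonempty_pairHomology_act_equiv pN.surj pN.ker_eq hG hJ
  filter_upwards [hE.eventually_matCoker_equiv (e'.symm.trans e), hE.exact _ _ hG, hE.exact _ _ hJ,
    hE.eventually_exists_matrix G, hE.eventually_exists_matrix J] with t ht htG htJ ⟨G', hG'⟩
    ⟨J', hJ'⟩ U' V' C' D' hU hV hC hD
  obtain ⟨d⟩ := ht J'.toRows₁ D' hJ'.toRows₁ hD
  obtain ⟨d'⟩ := nonempty_pairHomology_act_equiv (Submodule.mkQ_surjective _)
    (Submodule.ker_mkQ (LinearMap.range C'.mulVecLin))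
    (htG _ _ (Entrywise.fromCols (hE.matrix_kronecker hU hE.matrix_one)
      (hE.matrix_kronecker hE.matrix_one hC)) hG')
    (htJ _ _ (Entrywise.fromCols hG'.toRows₁ (Entrywise.fromCols (hE.matrix_kronecker hE.matrix_one hC)
      (hE.matrix_kronecker hV hE.matrix_one))) hJ')
  exact ⟨d'.trans d⟩

end CoreTheorem

section AlmostAll

open Filter

/-- The filter of sets of parameters containing almost all parameters. -/
def almostAll (K : Type) [Field K] (m : ℕ) : Filter (Fin m → K) where
  sets := {s | AlmostAll K m (· ∈ s)}
  univ_sets := ⟨1, one_ne_zero, fun _ _ => trivial⟩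
  sets_of_superset := fun ⟨c, hc, h⟩ hst => ⟨c, hc, fun α hα => hst (h α hα)⟩
  inter_sets := fun ⟨c, hc, h⟩ ⟨d, hd, h'⟩ => ⟨c * d, mul_ne_zero hc hd, fun α hα => by
    rw [map_mul] at hα
    exact ⟨h α (left_ne_zero_of_mul hα), h' α (right_ne_zero_of_mul hα)⟩⟩

theorem eventually_almostAll {m : ℕ} {Q : (Fin m → K) → Prop} :
    (∀ᶠ α in almostAll K m, Q α) ↔ AlmostAll K m Q :=
  Iff.rfl

theorem coe_evalα {m : ℕ} (α : Fin m → K) (c : MvPolynomial (Fin m) k) :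
    (evalα k K α c : K) = aeval α c := by
  have h : ((kA k K α).val.comp (aeval fun i =>
      (⟨α i, IntermediateField.subset_adjoin k (Set.range α) ⟨i, rfl⟩⟩ : kA k K α))) = aeval α := by
    ext i
    simp
  exact DFunLike.congr_fun h c

theorem eventually_evalα_ne_zero {m : ℕ} {c : MvPolynomial (Fin m) k} (hc : c ≠ 0) :
    ∀ᶠ α in almostAll K m, evalα k K α c ≠ 0 := by
  refine ⟨map (algebraMap k K) c, ?_, fun α hα h => hα ?_⟩
  · rwa [Ne, map_eq_zero_iff _ (map_injective _ (algebraMap k K).injective)]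
  · rw [eval_map, ← aeval_def, ← coe_evalα, h, ZeroMemClass.coe_zero]

theorem exists_mul_evalα_eq {m : ℕ} (α : Fin m → K) (x : kA k K α) :
    ∃ p q : MvPolynomial (Fin m) k, evalα k K α q ≠ 0 ∧ x * evalα k K α q = evalα k K α p := by
  obtain ⟨p, q, h⟩ := (IntermediateField.mem_adjoin_range_iff k α (x : K)).1 x.2
  by_cases hq : aeval α q = 0
  · refine ⟨0, 1, by simp, ?_⟩
    rw [hq, div_zero] at h
    rw [map_zero, show x = 0 from Subtype.ext h, zero_mul]
  · rw [← coe_evalα] at hq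
    refine ⟨p, q, fun h0 => hq (by rw [h0, ZeroMemClass.coe_zero]), Subtype.ext ?_⟩
    rw [← coe_evalα, ← coe_evalα, eq_div_iff hq] at h
    exact h

theorem eventually_kernel_toRa {m n : ℕ} {ρ σ : Type} [Finite ρ] [Fintype σ]
    (U : Matrix ρ σ (MvPolynomial (Fin n) (MvPolynomial (Fin m) k))) :
    ∀ᶠ α in almostAll K m, ∀ v : σ → Ra k K n α, (U.map (toRa k K n α)).mulVec v = 0 →
      ∃ w : σ → MvPolynomial (Fin n) (MvPolynomial (Fin m) k), U.mulVec w = 0 ∧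
        ∃ a : kA k K α, a ≠ 0 ∧ ∀ i, C a * v i = toRa k K n α (w i) := by
  obtain ⟨c, hc, h⟩ := exists_kernel_specialization U
  filter_upwards [eventually_evalα_ne_zero hc] with α hα
  exact h _ (evalα k K α) hα (exists_mul_evalα_eq α)

theorem eventually_toRa_notMem {m n : ℕ} {P : Ideal (Rg k m n)} [P.IsPrime]
    {g : MvPolynomial (Fin n) (MvPolynomial (Fin m) k)} (hg : toR k m n g ∉ P) :
    ∀ᶠ α in almostAll K m, ∀ ℘ : Ideal (Ra k K n α),
      IsAssociatedPrime ℘ (Ra k K n α ⧸ idealSpec k K n α P) → toRa k K n α g ∉ ℘ := by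
  obtain ⟨r, f, hf⟩ := Submodule.fg_iff_exists_fin_generating_family.1
    (IsNoetherian.noetherian (P.comap (toR k m n)))
  filter_upwards [eventually_kernel_toRa (K := K)
    (Matrix.of fun (_ : Unit) (j : Option (Fin r)) => j.elim g f)] with α hα
  have hspan : idealSpec k K n α P = Ideal.span (Set.range (toRa k K n α ∘ f)) := by
    have : idealSpec k K n α P = (P.comap (toR k m n)).map (toRa k K n α) := rfl
    rw [this, ← hf, Set.range_comp]
    exact Ideal.map_span _ _
  have hreg : ∀ x, toRa k K n α g * x ∈ idealSpec k K n α P → x ∈ idealSpec k K n α P := by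
    intro x hx
    rw [hspan, Ideal.mem_span_range_iff_exists_fun] at hx
    obtain ⟨c, hc⟩ := hx
    obtain ⟨w, hw, a, ha, h⟩ := hα (fun j => j.elim x fun i => -c i) (by
      funext u
      simp only [Matrix.mulVec, dotProduct, Fintype.sum_option, Matrix.map_apply, Matrix.of_apply,
        Option.elim, Pi.zero_apply]
      rw [← hc]
      simp only [Function.comp_apply, ← Finset.sum_add_distrib]
      exact Finset.sum_eq_zero fun i _ => by ring)
    have hwP : toR k m n (w none) ∈ P := by
      have h0 : g * w none + ∑ i, f i * w (some i) = 0 := by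
        simpa [Matrix.mulVec, dotProduct, Fintype.sum_option] using congrFun hw ()
      have h1 : g * w none ∈ P.comap (toR k m n) := by
        rw [eq_neg_of_add_eq_zero_left h0]
        refine neg_mem (sum_mem fun i _ => Ideal.mul_mem_right _ _ ?_)
        rw [← hf]
        exact Submodule.subset_span ⟨i, rfl⟩
      rw [Ideal.mem_comap, map_mul] at h1
      exact (Ideal.IsPrime.mem_or_mem ‹_› h1).resolve_left hg
    have h2 : C a * x ∈ idealSpec k K n α P := by
      have := h none
      simp only [Option.elim] at this
      rw [this]
      exact Ideal.subset_span ⟨_, hwP, rfl⟩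
    have h3 := Ideal.mul_mem_left _ (C a⁻¹) h2
    rwa [← mul_assoc, ← C_mul, inv_mul_cancel₀ ha, C_1, one_mul] at h3
  rintro ℘ ⟨hprime, y, hy⟩ hmem
  obtain ⟨x, rfl⟩ := Ideal.Quotient.mk_surjective y
  have hann : ∀ z, z ∈ (⊥ : Submodule (Ra k K n α) (Ra k K n α ⧸ idealSpec k K n α P)).colon
      {Ideal.Quotient.mk _ x} ↔ z * x ∈ idealSpec k K n α P := by
    intro z
    rw [Submodule.mem_colon_singleton, Submodule.mem_bot, ← Ideal.Quotient.eq_zero_iff_mem, map_mul]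
    rfl
  rw [hy] at hmem
  obtain ⟨N, hN⟩ := hmem
  rw [hann] at hN
  have hx : x ∈ idealSpec k K n α P := by
    clear hy hann
    induction N with
    | zero => simpa using hN
    | succ N ih => exact ih (hreg _ (by rwa [← mul_assoc, ← pow_succ']))
  refine hprime.ne_top ((Ideal.eq_top_iff_one _).2 ?_)
  rw [hy]
  exact Ideal.le_radical ((hann 1).2 (by rwa [one_mul]))

/-- A parameter `α` together with a localization of `k(α)[X]` at an associated prime of `P_α`. -/
structure LocalPoint (K : Type) [Field K] [Algebra k K] {m n : ℕ} (P : Ideal (Rg k m n)) where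
  α : Fin m → K
  ℘ : Ideal (Ra k K n α)
  assoc : IsAssociatedPrime ℘ (Ra k K n α ⧸ idealSpec k K n α P)
  Sα : Type
  [commRing : CommRing Sα]
  [algebra : Algebra (Ra k K n α) Sα]
  [isLocalization : haveI := assoc.isPrime; IsLocalization.AtPrime Sα ℘]

attribute [instance] LocalPoint.commRing LocalPoint.algebra

instance {m n : ℕ} {P : Ideal (Rg k m n)} (t : LocalPoint K P) : t.℘.IsPrime := t.assoc.isPrime

instance {m n : ℕ} {P : Ideal (Rg k m n)} (t : LocalPoint K P) : IsLocalization.AtPrime t.Sα t.℘ :=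
  t.isLocalization

/-- The map `k[u][X] → S_α`. -/
def LocalPoint.toLocal {m n : ℕ} {P : Ideal (Rg k m n)} (t : LocalPoint K P) :
    MvPolynomial (Fin n) (MvPolynomial (Fin m) k) →+* t.Sα :=
  (algebraMap (Ra k K n t.α) t.Sα).comp (toRa k K n t.α)

variable {m n : ℕ} (P : Ideal (Rg k m n)) [P.IsPrime] (S : Type) [CommRing S]
  [Algebra (Rg k m n) S] [IsLocalization.AtPrime S P]

theorem isUnit_algebraMap_iff (f : Rg k m n) : IsUnit (algebraMap (Rg k m n) S f) ↔ f ∉ P :=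
  IsLocalization.AtPrime.isUnit_to_map_iff S P f

theorem exists_denominator_toR (f : Rg k m n) : ∃ q : MvPolynomial (Fin m) k, q ≠ 0 ∧
    ∃ g, toR k m n g = C (algebraMap _ (kU k m) q) * f := by
  obtain ⟨q, hq, g, h⟩ := exists_denominator (algebraMap (MvPolynomial (Fin m) k) (kU k m))
    (fun x => by
      obtain ⟨⟨p, q⟩, h⟩ := IsLocalization.surj (nonZeroDivisors (MvPolynomial (Fin m) k)) x
      exact ⟨p, q, IsFractionRing.to_map_ne_zero_of_mem_nonZeroDivisors q.2, h⟩) f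
  exact ⟨q, fun h0 => hq (by rw [h0, map_zero]), g, h⟩

theorem C_notMem {F : Type} [Field F] {I : Ideal (MvPolynomial (Fin n) F)} (hI : I.IsPrime) {a : F}
    (ha : a ≠ 0) : C a ∉ I := fun h =>
  hI.ne_top (Ideal.eq_top_of_isUnit_mem _ h ((isUnit_iff_ne_zero.2 ha).map C))

theorem algebraMap_ne_zero {q : MvPolynomial (Fin m) k} (hq : q ≠ 0) :
    algebraMap _ (kU k m) q ≠ 0 :=
  (map_ne_zero_iff _ (IsFractionRing.injective _ _)).2 hq

theorem isSpecialization_localPoint : IsSpecialization (Filter.comap LocalPoint.α (almostAll K m))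
    (fun t : LocalPoint K P => t.Sα)
    (fun t => FracRel ((algebraMap (Rg k m n) S).comp (toR k m n)) t.toLocal) := by
  refine isSpecialization_fracRel (B := MvPolynomial (Fin n) (MvPolynomial (Fin m) k))
    (T := fun t : LocalPoint K P => t.Sα) (φ := (algebraMap (Rg k m n) S).comp (toR k m n))
    (ψ := LocalPoint.toLocal) ?_ ?_ _ ?_ ?_
  · exact (IsLocalization.injective S P.primeCompl_le_nonZeroDivisors).comp
      (map_injective _ (IsFractionRing.injective _ _))
  · intro a
    obtain ⟨⟨p, g⟩, h⟩ := IsLocalization.surj P.primeCompl a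
    obtain ⟨q, hq, p', hp⟩ := exists_denominator_toR p
    obtain ⟨r, hr, g', hg⟩ := exists_denominator_toR (g : Rg k m n)
    refine ⟨p' * C r, g' * C q, ?_, ?_⟩
    · simp only [RingHom.comp_apply, map_mul, hg, isUnit_algebraMap_iff P S, IsUnit.mul_iff]
      simp only [toR, map_C]
      exact ⟨⟨C_notMem ‹_› (algebraMap_ne_zero hr), g.2⟩, C_notMem ‹_› (algebraMap_ne_zero hq)⟩
    · simp only [RingHom.comp_apply, map_mul, hg, hp]
      rw [← h]
      simp only [toR, map_C]
      ring
  · intro g hg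
    rw [RingHom.comp_apply, isUnit_algebraMap_iff P S] at hg
    refine Filter.mem_of_superset (Filter.preimage_mem_comap (eventually_toRa_notMem hg)) ?_
    intro t ht
    exact (IsLocalization.AtPrime.isUnit_to_map_iff t.Sα t.℘ _).2 (ht t.℘ t.assoc)
  · intro ρ σ _ _ U
    refine Filter.mem_of_superset (Filter.preimage_mem_comap (eventually_kernel_toRa U)) ?_
    intro t ht v hv
    obtain ⟨s, hs⟩ := IsLocalization.exist_integer_multiples_of_finite t.℘.primeCompl v
    choose v' hv' using hs
    have hinj : Function.Injective (algebraMap (Ra k K n t.α) t.Sα) :=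
      IsLocalization.injective t.Sα t.℘.primeCompl_le_nonZeroDivisors
    obtain ⟨w, hw, a, ha, h⟩ := ht v' (by
      funext i
      apply hinj
      have := congrFun hv i
      simp only [Matrix.mulVec, dotProduct, Matrix.map_apply, LocalPoint.toLocal,
        RingHom.comp_apply, Pi.zero_apply] at this
      simp only [Matrix.mulVec, dotProduct, Matrix.map_apply, Pi.zero_apply, map_zero, map_sum,
        map_mul, hv', Algebra.smul_def]
      rw [← mul_zero (algebraMap (Ra k K n t.α) t.Sα s), ← this, Finset.mul_sum]
      exact Finset.sum_congr rfl fun j _ => by ring)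
    refine ⟨w, hw, algebraMap _ _ (C a * (s : Ra k K n t.α)), ?_, fun i => ?_⟩
    · rw [IsLocalization.AtPrime.isUnit_to_map_iff t.Sα t.℘]
      exact fun hm => (Ideal.IsPrime.mem_or_mem inferInstance hm).elim
        (C_notMem inferInstance ha) s.2
    · rw [map_mul, mul_assoc, ← Algebra.smul_def (s : Ra k K n t.α) (v i), ← hv', ← map_mul, h]
      rfl

variable {P S} in
theorem LocElemSpec.fracRel (t : LocalPoint K P) {a : S} {x : t.Sα}
    (h : LocElemSpec P t.℘ a x) :
    FracRel ((algebraMap (Rg k m n) S).comp (toR k m n)) t.toLocal a x := by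
  obtain ⟨f, g, fα, gα, hg, hgα, ⟨p, q, hq, h1, h2⟩, ⟨p', q', hq', h3, h4⟩, rfl, rfl⟩ := h
  have hne : ∀ {q : MvPolynomial (Fin m) k}, evalα k K t.α q ≠ 0 → q ≠ 0 := fun hq h0 =>
    hq (by rw [h0, map_zero])
  refine ⟨p * C q', p' * C q, ?_, ?_, ?_, ?_⟩
  · simp only [RingHom.comp_apply, map_mul, ← h3, isUnit_algebraMap_iff P S, IsUnit.mul_iff]
    simp only [toR, map_C]
    exact ⟨⟨C_notMem ‹_› (algebraMap_ne_zero (hne hq')), hg⟩,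
      C_notMem ‹_› (algebraMap_ne_zero (hne hq))⟩
  · simp only [LocalPoint.toLocal, RingHom.comp_apply, map_mul, ← h4,
      IsLocalization.AtPrime.isUnit_to_map_iff t.Sα t.℘, IsUnit.mul_iff]
    simp only [toRa, map_C]
    exact ⟨⟨C_notMem inferInstance hq', hgα⟩, C_notMem inferInstance hq⟩
  · simp only [RingHom.comp_apply, map_mul, ← h1, ← h3]
    rw [← IsLocalization.mk'_spec S f ⟨g, hg⟩]
    simp only [toR, map_C]
    ring
  · simp only [LocalPoint.toLocal, RingHom.comp_apply, map_mul, ← h2, ← h4]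
    rw [← IsLocalization.mk'_spec t.Sα fα ⟨gα, hgα⟩]
    simp only [toRa, map_C]
    ring

end AlmostAll

section Resolution

open CategoryTheory

theorem exists_exact_extension {R : Type} [CommRing R] [IsNoetherianRing R] (r : ℕ → ℕ)
    (A : ∀ j, Matrix (Fin (r j)) (Fin (r (j + 1))) R) (N : ℕ)
    (hA : ∀ j < N, LinearMap.ker (A j).mulVecLin = LinearMap.range (A (j + 1)).mulVecLin) :
    ∃ (r' : ℕ → ℕ) (A' : ∀ j, Matrix (Fin (r' j)) (Fin (r' (j + 1))) R),
      (∀ j, LinearMap.ker (A' j).mulVecLin = LinearMap.range (A' (j + 1)).mulVecLin) ∧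
      ∀ j ≤ N, (⟨r' j, r' (j + 1), A' j⟩ : Σ p q : ℕ, Matrix (Fin p) (Fin q) R) =
        ⟨r j, r (j + 1), A j⟩ := by
  have hnext : ∀ (j : ℕ) (x : Σ p q : ℕ, Matrix (Fin p) (Fin q) R),
      ∃ y : Σ s : ℕ, Matrix (Fin x.2.1) (Fin s) R,
        LinearMap.ker x.2.2.mulVecLin = LinearMap.range y.2.mulVecLin ∧
        (j < N → x = ⟨r j, r (j + 1), A j⟩ →
          (⟨x.2.1, y⟩ : Σ p q : ℕ, Matrix (Fin p) (Fin q) R) =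
            ⟨r (j + 1), r (j + 2), A (j + 1)⟩) := by
    intro j x
    by_cases h : j < N ∧ x = ⟨r j, r (j + 1), A j⟩
    · obtain ⟨hj, rfl⟩ := h
      exact ⟨⟨_, A (j + 1)⟩, hA j hj, fun _ _ => rfl⟩
    · obtain ⟨s, W, hW⟩ := exists_kernel_matrix x.2.2
      exact ⟨⟨s, W⟩, hW, fun h1 h2 => absurd ⟨h1, h2⟩ h⟩
  choose next hker heq using hnext
  let Y : ℕ → Σ p q : ℕ, Matrix (Fin p) (Fin q) R := fun j =>
    Nat.rec ⟨r 0, r 1, A 0⟩ (fun j x => ⟨x.2.1, next j x⟩) j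
  refine ⟨fun j => (Y j).1, fun j => (Y j).2.2, fun j => hker j (Y j), fun j hj => ?_⟩
  change Y j = _
  induction j with
  | zero => rfl
  | succ j ih => exact heq j (Y j) (by omega) (ih (by omega))

/-- The complex of free modules given by matrices. -/
def matrixComplex {R : Type} [CommRing R] (r : ℕ → ℕ)
    (A : ∀ j, Matrix (Fin (r j)) (Fin (r (j + 1))) R)
    (hA : ∀ j, LinearMap.ker (A j).mulVecLin = LinearMap.range (A (j + 1)).mulVecLin) :
    ChainComplex (ModuleCat R) ℕ :=
  ChainComplex.of (fun j => ModuleCat.of R (Fin (r j) → R))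
    (fun j => ModuleCat.ofHom (A j).mulVecLin) (fun j => by
      rw [← ModuleCat.ofHom_comp, LinearMap.range_le_ker_iff.1 (hA j).ge]
      rfl)

section MatrixComplex

variable {R : Type} [CommRing R] {L : Type} [AddCommGroup L] [Module R L] (r : ℕ → ℕ)
    (A : ∀ j, Matrix (Fin (r j)) (Fin (r (j + 1))) R)
    (hA : ∀ j, LinearMap.ker (A j).mulVecLin = LinearMap.range (A (j + 1)).mulVecLin)

theorem matrixComplex_d (j : ℕ) :
    (matrixComplex r A hA).d (j + 1) j = ModuleCat.ofHom (A j).mulVecLin :=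
  ChainComplex.of_d (fun j => ModuleCat.of R (Fin (r j) → R))
    (fun j => ModuleCat.ofHom (A j).mulVecLin) j

/-- A free resolution given by matrices. -/
def matrixResolution (π : (Fin (r 0) → R) →ₗ[R] L) (hπ : Function.Surjective π)
    (hker : LinearMap.ker π = LinearMap.range (A 0).mulVecLin) :
    ProjectiveResolution (ModuleCat.of R L) where
  complex := matrixComplex r A hA
  projective j := ModuleCat.projective_of_free (Pi.basisFun R (Fin (r j)))
  π := (ChainComplex.toSingle₀Equiv _ _).symm ⟨ModuleCat.ofHom π, by
    rw [matrixComplex_d]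
    exact ModuleCat.hom_ext (LinearMap.range_le_ker_iff.1 hker.ge)⟩
  quasiIso := ⟨fun j => by
    cases j with
    | zero =>
      rw [ChainComplex.quasiIsoAt₀_iff, ShortComplex.quasiIso_iff_of_zeros']
      · have hw : ModuleCat.ofHom (A 0).mulVecLin ≫ ModuleCat.ofHom π = 0 :=
          ModuleCat.hom_ext (LinearMap.range_le_ker_iff.1 hker.ge)
        refine (ShortComplex.exact_and_epi_g_iff_of_iso
          (S₂ := ShortComplex.mk (ModuleCat.ofHom (A 0).mulVecLin) (ModuleCat.ofHom π) hw) ?_).2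
          ⟨(ShortComplex.moduleCat_exact_iff_range_eq_ker _).2 hker.symm,
            (ModuleCat.epi_iff_surjective _).2 hπ⟩
        refine ShortComplex.isoMk (Iso.refl _) (Iso.refl _) (Iso.refl _) ?_ ?_
        · exact (Category.id_comp _).trans ((matrixComplex_d r A hA 0).symm.trans
            (Category.comp_id _).symm)
        · exact (Category.id_comp _).trans ((ChainComplex.toSingle₀Equiv_symm_apply_f_zero
            (C := matrixComplex r A hA) (X := ModuleCat.of R L) (ModuleCat.ofHom π) (by
              rw [matrixComplex_d]
              exact hw)).symm.trans (Category.comp_id _).symm)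
      all_goals rfl
    | succ j =>
      rw [quasiIsoAt_iff_exactAt']
      · rw [HomologicalComplex.exactAt_iff' _ (j + 2) (j + 1) j (by simp) (by simp),
          ShortComplex.moduleCat_exact_iff_range_eq_ker]
        change LinearMap.range ((matrixComplex r A hA).d (j + 1 + 1) (j + 1)).hom =
          LinearMap.ker ((matrixComplex r A hA).d (j + 1) j).hom
        rw [matrixComplex_d, matrixComplex_d]
        exact (hA j).symm
      · apply ChainComplex.exactAt_succ_single_obj⟩

end MatrixComplex

/-- The matrix `A (i - 1)`, or zero for `i = 0`. -/
def prevMat {R : Type} [CommRing R] {r : ℕ → ℕ} (A : ∀ j, Matrix (Fin (r j)) (Fin (r (j + 1))) R) :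
    ∀ i, Matrix (Fin (r (i - 1))) (Fin (r i)) R
  | 0 => 0
  | i + 1 => A i

section Homology

variable {R : Type} [CommRing R]

theorem nonempty_homology_equiv (C : ShortComplex (ModuleCat.{0} R)) :
    Nonempty (C.homology ≃ₗ[R] PairHomology C.f.hom C.g.hom) := by
  refine ⟨C.moduleCatHomologyIso.toLinearEquiv.trans (Submodule.quotEquivOfEq _ _ ?_)⟩
  exact LinearMap.range_codRestrict _ _ _

variable {L M : Type} [AddCommGroup L] [Module R L] [AddCommGroup M] [Module R M] (r : ℕ → ℕ)
    (A : ∀ j, Matrix (Fin (r j)) (Fin (r (j + 1))) R)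

theorem matrixComplex_d_prev
    (hA : ∀ j, LinearMap.ker (A j).mulVecLin = LinearMap.range (A (j + 1)).mulVecLin) (i : ℕ) :
    (matrixComplex r A hA).d i (i - 1) = ModuleCat.ofHom (prevMat A i).mulVecLin := by
  cases i with
  | zero =>
    rw [HomologicalComplex.shape _ _ _ (by simp)]
    exact ModuleCat.hom_ext (Matrix.mulVecLin_zero).symm
  | succ i => exact matrixComplex_d r A hA i

theorem down_next (i : ℕ) : (ComplexShape.down ℕ).next i = i - 1 := by
  cases i <;> simp

theorem up_prev (i : ℕ) : (ComplexShape.up ℕ).prev i = i - 1 := by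
  cases i <;> simp

variable (L) in
theorem piScalarRight_lTensor {p q : ℕ} (U : Matrix (Fin p) (Fin q) R) (x) :
    TensorProduct.piScalarRight R R L (Fin p) (U.mulVecLin.lTensor L x) =
      act U L (TensorProduct.piScalarRight R R L (Fin q) x) := by
  induction x with
  | zero => simp
  | add x y hx hy => simp only [map_add, hx, hy]
  | tmul l f =>
    funext j
    simp [act_apply, Matrix.mulVec, dotProduct, Finset.sum_smul, mul_smul]

/-- Homomorphisms out of a free module are families of elements. -/
def homEquiv (q : ℕ) : (ModuleCat.of R (Fin q → R) ⟶ ModuleCat.of R M) ≃ₗ[R] (Fin q → M) :=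
  ModuleCat.homLinearEquiv.trans ((Pi.basisFun R (Fin q)).constr R).symm

theorem homEquiv_apply {q : ℕ} (f : ModuleCat.of R (Fin q → R) ⟶ ModuleCat.of R M) (j : Fin q) :
    homEquiv q f j = f.hom (Pi.single j 1) := by
  rw [← Pi.basisFun_apply]
  rfl

theorem homEquiv_comp {p q : ℕ} (U : Matrix (Fin p) (Fin q) R)
    (f : ModuleCat.of R (Fin p → R) ⟶ ModuleCat.of R M) :
    homEquiv q (ModuleCat.ofHom U.mulVecLin ≫ f) = act U.transpose M (homEquiv p f) := by
  funext j
  simp only [act_apply, homEquiv_apply, ← map_smul, ← map_sum]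
  change f.hom (U.mulVec (Pi.single j 1)) = _
  congr 1
  funext i
  simp [Pi.single_apply]

theorem nonempty_tor_equiv_of_resolution
    (hA : ∀ j, LinearMap.ker (A j).mulVecLin = LinearMap.range (A (j + 1)).mulVecLin)
    (π : (Fin (r 0) → R) →ₗ[R] M) (hπ : Function.Surjective π)
    (hker : LinearMap.ker π = LinearMap.range (A 0).mulVecLin) (i : ℕ) :
    Nonempty ((((Tor (ModuleCat.{0} R) i).obj (ModuleCat.of R L)).obj (ModuleCat.of R M)) ≃ₗ[R]
      PairHomology (act (A i) L) (act (prevMat A i) L)) := by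
  let P := matrixResolution r A hA π hπ hker
  let F := (MonoidalCategory.tensoringLeft (ModuleCat.{0} R)).obj (ModuleCat.of R L)
  let C := (F.mapHomologicalComplex (ComplexShape.down ℕ)).obj P.complex
  have e1 : (((Tor (ModuleCat.{0} R) i).obj (ModuleCat.of R L)).obj (ModuleCat.of R M)) ≅
      (C.sc' (i + 1) i (i - 1)).homology :=
    P.isoLeftDerivedObj F i ≪≫ C.homologyIsoSc' (i + 1) i (i - 1) (by simp) (down_next i)
  obtain ⟨e2⟩ := nonempty_homology_equiv (C.sc' (i + 1) i (i - 1))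
  obtain ⟨e3⟩ := nonempty_pairHomology_congr (f := (C.sc' (i + 1) i (i - 1)).f.hom)
    (g := (C.sc' (i + 1) i (i - 1)).g.hom) (f' := act (A i) L) (g' := act (prevMat A i) L)
    (TensorProduct.piScalarRight R R L (Fin (r (i + 1))))
    (TensorProduct.piScalarRight R R L (Fin (r i)))
    (TensorProduct.piScalarRight R R L (Fin (r (i - 1))))
    (fun x => by
      refine Eq.trans ?_ (piScalarRight_lTensor L (A i) x)
      refine congrArg (TensorProduct.piScalarRight R R L (Fin (r i))) ?_
      change (F.map ((matrixComplex r A hA).d (i + 1) i)).hom x = _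
      rw [matrixComplex_d]
      rfl)
    (fun x => by
      refine Eq.trans ?_ (piScalarRight_lTensor L (prevMat A i) x)
      refine congrArg (TensorProduct.piScalarRight R R L (Fin (r (i - 1)))) ?_
      change (F.map ((matrixComplex r A hA).d i (i - 1))).hom x = _
      rw [matrixComplex_d_prev]
      rfl)
  exact ⟨e1.toLinearEquiv.trans (e2.trans e3)⟩

theorem nonempty_ext_equiv_of_resolution
    (hA : ∀ j, LinearMap.ker (A j).mulVecLin = LinearMap.range (A (j + 1)).mulVecLin)
    (π : (Fin (r 0) → R) →ₗ[R] L) (hπ : Function.Surjective π)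
    (hker : LinearMap.ker π = LinearMap.range (A 0).mulVecLin) (i : ℕ) :
    Nonempty ((((Ext R (ModuleCat.{0} R) i).obj (Opposite.op (ModuleCat.of R L))).obj
      (ModuleCat.of R M)) ≃ₗ[R]
        PairHomology (act (prevMat A i).transpose M) (act (A i).transpose M)) := by
  let P := matrixResolution r A hA π hπ hker
  let C := P.complex.linearYonedaObj R (ModuleCat.of R M)
  have e1 : (((Ext R (ModuleCat.{0} R) i).obj (Opposite.op (ModuleCat.of R L))).obj
      (ModuleCat.of R M)) ≅ (C.sc' (i - 1) i (i + 1)).homology :=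
    P.isoExt i _ ≪≫ C.homologyIsoSc' (i - 1) i (i + 1) (up_prev i) (by simp)
  obtain ⟨e2⟩ := nonempty_homology_equiv (C.sc' (i - 1) i (i + 1))
  obtain ⟨e3⟩ := nonempty_pairHomology_congr (f := (C.sc' (i - 1) i (i + 1)).f.hom)
    (g := (C.sc' (i - 1) i (i + 1)).g.hom) (f' := act (prevMat A i).transpose M)
    (g' := act (A i).transpose M) (homEquiv (r (i - 1))) (homEquiv (r i)) (homEquiv (r (i + 1)))
    (fun x => by
      refine Eq.trans ?_ (homEquiv_comp (prevMat A i) x)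
      rw [← matrixComplex_d_prev r A hA]
      rfl)
    (fun x => by
      refine Eq.trans ?_ (homEquiv_comp (A i) x)
      rw [← matrixComplex_d r A hA]
      rfl)
  exact ⟨e1.toLinearEquiv.trans (e2.trans e3)⟩

theorem exists_resolution_extension [IsNoetherianRing R] (i : ℕ)
    (hA : ∀ j < i, LinearMap.ker (A j).mulVecLin = LinearMap.range (A (j + 1)).mulVecLin)
    (π : (Fin (r 0) → R) →ₗ[R] L) (hπ : Function.Surjective π)
    (hker : LinearMap.ker π = LinearMap.range (A 0).mulVecLin) :
    ∃ (r' : ℕ → ℕ) (A' : ∀ j, Matrix (Fin (r' j)) (Fin (r' (j + 1))) R)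
      (π' : (Fin (r' 0) → R) →ₗ[R] L),
      (∀ j, LinearMap.ker (A' j).mulVecLin = LinearMap.range (A' (j + 1)).mulVecLin) ∧
      Function.Surjective π' ∧ LinearMap.ker π' = LinearMap.range (A' 0).mulVecLin ∧
      (⟨r' (i - 1), r' i, prevMat A' i⟩ : Σ p q : ℕ, Matrix (Fin p) (Fin q) R) =
        ⟨r (i - 1), r i, prevMat A i⟩ ∧
      (⟨r' i, r' (i + 1), A' i⟩ : Σ p q : ℕ, Matrix (Fin p) (Fin q) R) =
        ⟨r i, r (i + 1), A i⟩ := by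
  obtain ⟨r', A', hA', h⟩ := exists_exact_extension r A i hA
  have hπ' : ∀ x : Σ p q : ℕ, Matrix (Fin p) (Fin q) R, x = ⟨r 0, r 1, A 0⟩ →
      ∃ π' : (Fin x.1 → R) →ₗ[R] L, Function.Surjective π' ∧
        LinearMap.ker π' = LinearMap.range x.2.2.mulVecLin := by
    rintro _ rfl
    exact ⟨π, hπ, hker⟩
  obtain ⟨π', hπ', hker'⟩ := hπ' _ (h 0 (Nat.zero_le i))
  refine ⟨r', A', π', hA', hπ', hker', ?_, h i le_rfl⟩
  cases i with
  | zero =>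
    exact congrArg (fun x : Σ p q : ℕ, Matrix (Fin p) (Fin q) R =>
      (⟨x.1, x.1, 0⟩ : Σ p q : ℕ, Matrix (Fin p) (Fin q) R)) (h 0 le_rfl)
  | succ i => exact h i (Nat.le_succ i)

theorem nonempty_tor_equiv [IsNoetherianRing R] (i : ℕ)
    (hA : ∀ j < i, LinearMap.ker (A j).mulVecLin = LinearMap.range (A (j + 1)).mulVecLin)
    (π : (Fin (r 0) → R) →ₗ[R] M) (hπ : Function.Surjective π)
    (hker : LinearMap.ker π = LinearMap.range (A 0).mulVecLin) :
    Nonempty ((((Tor (ModuleCat.{0} R) i).obj (ModuleCat.of R L)).obj (ModuleCat.of R M)) ≃ₗ[R]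
      PairHomology (act (A i) L) (act (prevMat A i) L)) := by
  obtain ⟨r', A', π', hA', hπ', hker', h1, h2⟩ := exists_resolution_extension r A i hA π hπ hker
  have h := nonempty_tor_equiv_of_resolution (L := L) r' A' hA' π' hπ' hker' i
  generalize prevMat A' i = U' at h h1
  generalize prevMat A i = U at h1 ⊢
  generalize A' i = V' at h h2
  generalize A i = V at h2 ⊢
  generalize r' (i - 1) = a', r' i = b', r' (i + 1) = c' at *
  cases h1
  cases h2
  exact h

theorem nonempty_ext_equiv [IsNoetherianRing R] (i : ℕ)
    (hA : ∀ j < i, LinearMap.ker (A j).mulVecLin = LinearMap.range (A (j + 1)).mulVecLin)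
    (π : (Fin (r 0) → R) →ₗ[R] L) (hπ : Function.Surjective π)
    (hker : LinearMap.ker π = LinearMap.range (A 0).mulVecLin) :
    Nonempty ((((Ext R (ModuleCat.{0} R) i).obj (Opposite.op (ModuleCat.of R L))).obj
      (ModuleCat.of R M)) ≃ₗ[R]
        PairHomology (act (prevMat A i).transpose M) (act (A i).transpose M)) := by
  obtain ⟨r', A', π', hA', hπ', hker', h1, h2⟩ := exists_resolution_extension r A i hA π hπ hker
  have h := nonempty_ext_equiv_of_resolution (M := M) r' A' hA' π' hπ' hker' i
  generalize prevMat A' i = U' at h h1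
  generalize prevMat A i = U at h1 ⊢
  generalize A' i = V' at h h2
  generalize A i = V at h2 ⊢
  generalize r' (i - 1) = a', r' i = b', r' (i + 1) = c' at *
  cases h1
  cases h2
  exact h

end Homology

section Specialization

variable {S : Type} {Λ : Type*} [CommRing S] [IsNoetherianRing S] {l : Filter Λ} {T : Λ → Type}
  [∀ t, CommRing (T t)] {E : ∀ t, S → T t → Prop}

/-- The isomorphism between a presented module and the cokernel of its matrix. -/
def Present.equiv {r s : ℕ} {L : Type} [AddCommGroup L] [Module S L] (p : Present S r s L) :
    MatCoker p.A ≃ₗ[S] L :=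
  (Submodule.quotEquivOfEq _ _ p.ker_eq.symm).trans (p.π.quotKerEquivOfSurjective p.surj)

theorem Present.exists_resolution {r s : ℕ} {L : Type} [AddCommGroup L] [Module S L]
    (p : Present S r s L) :
    ∃ (ρ : ℕ → ℕ) (A : ∀ j, Matrix (Fin (ρ j)) (Fin (ρ (j + 1))) S),
      (∀ j, LinearMap.ker (A j).mulVecLin = LinearMap.range (A (j + 1)).mulVecLin) ∧
      (⟨ρ 0, ρ 1, A 0⟩ : Σ p q : ℕ, Matrix (Fin p) (Fin q) S) = ⟨r, s, p.A⟩ := by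
  obtain ⟨ρ, A, hA, h⟩ := exists_exact_extension (fun j => Nat.rec r (fun _ _ => s) j)
    (fun j => Nat.rec (motive := fun j => Matrix (Fin (Nat.rec r (fun _ _ => s) j)) (Fin s) S)
      p.A (fun _ _ => 0) j) 0 (by simp)
  exact ⟨ρ, A, hA, h 0 le_rfl⟩

namespace IsSpecialization

variable (hE : IsSpecialization l T E)

include hE

omit [IsNoetherianRing S] in
theorem prevMat {t : Λ} {r : ℕ → ℕ} {A : ∀ j, Matrix (Fin (r j)) (Fin (r (j + 1))) S}
    {A' : ∀ j, Matrix (Fin (r j)) (Fin (r (j + 1))) (T t)} {i : ℕ}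
    (h : ∀ j ≤ i, Entrywise (E t) (A j) (A' j)) :
    Entrywise (E t) (prevMat A i) (Spl.prevMat A' i) := by
  cases i with
  | zero => exact hE.matrix_zero
  | succ i => exact h i (Nat.le_succ i)

omit [IsNoetherianRing S] in
theorem eventually_exists_resolution {r : ℕ → ℕ}
    (A : ∀ j, Matrix (Fin (r j)) (Fin (r (j + 1))) S)
    (hA : ∀ j, LinearMap.ker (A j).mulVecLin = LinearMap.range (A (j + 1)).mulVecLin) (i : ℕ) :
    ∀ᶠ t in l, ∃ A' : ∀ j, Matrix (Fin (r j)) (Fin (r (j + 1))) (T t),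
      (∀ j ≤ i, Entrywise (E t) (A j) (A' j)) ∧
      ∀ j < i, LinearMap.ker (A' j).mulVecLin = LinearMap.range (A' (j + 1)).mulVecLin := by
  have h1 := (Filter.eventually_all_finite (Set.finite_Iic i)).2
    fun j _ => hE.eventually_exists_matrix (A j)
  have h2 := (Filter.eventually_all_finite (Set.finite_Iic i)).2
    fun j _ => hE.exact (A j) (A (j + 1)) (hA j)
  filter_upwards [h1, h2] with t h1 h2
  have h : ∀ j, ∃ B : Matrix (Fin (r j)) (Fin (r (j + 1))) (T t),
      j ≤ i → Entrywise (E t) (A j) B := by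
    intro j
    by_cases hj : j ≤ i
    · obtain ⟨B, hB⟩ := h1 j hj
      exact ⟨B, fun _ => hB⟩
    · exact ⟨0, fun h => absurd h hj⟩
  choose A' hA' using h
  exact ⟨A', hA', fun j hj => h2 j hj.le _ _ (hA' j hj.le) (hA' (j + 1) hj)⟩

variable [∀ t, IsNoetherianRing (T t)] {L M : Type} [AddCommGroup L] [Module S L]
  [AddCommGroup M] [Module S M] {rL sL rM sM : ℕ}

theorem eventually_tor_equiv (pL : Present S rL sL L) (pM : Present S rM sM M) (i : ℕ)
    {rT sT : ℕ} (pT : Present S rT sT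
      (((Tor (ModuleCat S) i).obj (ModuleCat.of S L)).obj (ModuleCat.of S M))) :
    ∀ᶠ t in l, ∀ BL BM BT, Entrywise (E t) pL.A BL → Entrywise (E t) pM.A BM →
      Entrywise (E t) pT.A BT →
      Nonempty ((((Tor (ModuleCat (T t)) i).obj (ModuleCat.of (T t) (MatCoker BL))).obj
        (ModuleCat.of (T t) (MatCoker BM))) ≃ₗ[T t] MatCoker BT) := by
  obtain ⟨r, A, hA, h⟩ := pM.exists_resolution
  obtain ⟨A₀, π, hπ, hker⟩ := pM
  dsimp only at h ⊢
  cases h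
  obtain ⟨e⟩ := nonempty_tor_equiv (L := L) r A i (fun j _ => hA j) π hπ hker
  filter_upwards [hE.eventually_pairHomology_equiv (Spl.prevMat A i) (A i) pL
    (D := pT.A) ⟨e.symm.trans pT.equiv.symm⟩, hE.eventually_exists_resolution A hA i]
    with t ht ⟨A', hA', hex⟩ BL BM BT hL hM hT
  obtain ⟨e1⟩ := ht _ _ _ _ (hE.prevMat hA') (hA' i le_rfl) hL hT
  obtain rfl := hE.matrix_unique (hA' 0 (Nat.zero_le i)) hM
  obtain ⟨e2⟩ := nonempty_tor_equiv (L := MatCoker BL) r A' i hex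
    (Submodule.mkQ (LinearMap.range (A' 0).mulVecLin)) (Submodule.mkQ_surjective _)
    (Submodule.ker_mkQ _)
  exact ⟨e2.trans e1⟩

theorem eventually_ext_equiv (pL : Present S rL sL L) (pM : Present S rM sM M) (i : ℕ)
    {rE sE : ℕ} (pE : Present S rE sE
      (((Ext S (ModuleCat S) i).obj (Opposite.op (ModuleCat.of S L))).obj (ModuleCat.of S M))) :
    ∀ᶠ t in l, ∀ BL BM BE, Entrywise (E t) pL.A BL → Entrywise (E t) pM.A BM →
      Entrywise (E t) pE.A BE →
      Nonempty ((((Ext (T t) (ModuleCat (T t)) i).obj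
        (Opposite.op (ModuleCat.of (T t) (MatCoker BL)))).obj
        (ModuleCat.of (T t) (MatCoker BM))) ≃ₗ[T t] MatCoker BE) := by
  obtain ⟨r, A, hA, h⟩ := pL.exists_resolution
  obtain ⟨A₀, π, hπ, hker⟩ := pL
  dsimp only at h ⊢
  cases h
  obtain ⟨e⟩ := nonempty_ext_equiv (M := M) r A i (fun j _ => hA j) π hπ hker
  filter_upwards [hE.eventually_pairHomology_equiv (A i).transpose (Spl.prevMat A i).transpose pM
    (D := pE.A) ⟨e.symm.trans pE.equiv.symm⟩, hE.eventually_exists_resolution A hA i]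
    with t ht ⟨A', hA', hex⟩ BL BM BE hL hM hT
  obtain ⟨e1⟩ := ht _ _ _ _ (hA' i le_rfl).transpose (hE.prevMat hA').transpose hM hT
  obtain rfl := hE.matrix_unique (hA' 0 (Nat.zero_le i)) hL
  obtain ⟨e2⟩ := nonempty_ext_equiv (M := MatCoker BM) r A' i hex
    (Submodule.mkQ (LinearMap.range (A' 0).mulVecLin)) (Submodule.mkQ_surjective _)
    (Submodule.ker_mkQ _)
  exact ⟨e2.trans e1⟩

end IsSpecialization

end Specialization

end Resolution

open CategoryTheory in
/-- specialization commutes with Ext and Tor: for finitely generated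
`S`-modules `L` and `M` and each `i ≥ 0`, for almost all `α`,
`Ext^i_{S_α}(L_α, M_α) ≅ (Ext^i_S(L, M))_α` and
`Tor_i^{S_α}(L_α, M_α) ≅ (Tor_i^S(L, M))_α`, where the right hand sides are the
specializations of the `S`-modules `Ext^i_S(L,M)` and `Tor_i^S(L,M)` with respect
to chosen finite free presentations. -/
theorem specialization_commutes_with_ext_and_tor
    (k K : Type) [Field k] [Field K] [Algebra k K] [Infinite K] {m n : ℕ}
    (P : Ideal (Rg k m n)) [P.IsPrime]
    (S : Type) [CommRing S] [Algebra (Rg k m n) S] [IsLocalization.AtPrime S P]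
    (L M : Type) [AddCommGroup L] [Module S L] [Module.Finite S L]
    [AddCommGroup M] [Module S M] [Module.Finite S M]
    {rL sL rM sM : ℕ} (pL : Present S rL sL L) (pM : Present S rM sM M)
    (i : ℕ) {rE sE rT sT : ℕ}
    (pE : Present S rE sE
      (((Ext S (ModuleCat S) i).obj (Opposite.op (ModuleCat.of S L))).obj
        (ModuleCat.of S M)))
    (pT : Present S rT sT
      (((Tor (ModuleCat S) i).obj (ModuleCat.of S L)).obj (ModuleCat.of S M))) :
    AlmostAll K m fun α =>
      ∀ (℘ : Ideal (Ra k K n α))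
        (h℘ : IsAssociatedPrime ℘ ((Ra k K n α) ⧸ idealSpec k K n α P)),
        haveI := h℘.isPrime
        ∀ (Sα : Type) [CommRing Sα] [Algebra (Ra k K n α) Sα]
          [IsLocalization.AtPrime Sα ℘]
          (BL : Matrix (Fin rL) (Fin sL) Sα) (BM : Matrix (Fin rM) (Fin sM) Sα)
          (BE : Matrix (Fin rE) (Fin sE) Sα) (BT : Matrix (Fin rT) (Fin sT) Sα),
          MatSpec (LocElemSpec P ℘) pL.A BL → MatSpec (LocElemSpec P ℘) pM.A BM →
          MatSpec (LocElemSpec P ℘) pE.A BE → MatSpec (LocElemSpec P ℘) pT.A BT →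
          Nonempty
            ((((Ext Sα (ModuleCat Sα) i).obj
                (Opposite.op (ModuleCat.of Sα (MatCoker BL)))).obj
              (ModuleCat.of Sα (MatCoker BM))) ≃ₗ[Sα] MatCoker BE) ∧
          Nonempty
            ((((Tor (ModuleCat Sα) i).obj (ModuleCat.of Sα (MatCoker BL))).obj
              (ModuleCat.of Sα (MatCoker BM))) ≃ₗ[Sα] MatCoker BT) := by
  have : IsNoetherianRing S := IsLocalization.isNoetherianRing P.primeCompl S inferInstance
  have (t : LocalPoint K P) : IsNoetherianRing t.Sα :=
    IsLocalization.isNoetherianRing t.℘.primeCompl t.Sα inferInstance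
  have hE := isSpecialization_localPoint (K := K) P S
  have h := (hE.eventually_ext_equiv pL pM i pE).and (hE.eventually_tor_equiv pL pM i pT)
  rw [Filter.eventually_comap, eventually_almostAll] at h
  obtain ⟨c, hc, h⟩ := h
  refine ⟨c, hc, fun α hα ℘ h℘ Sα _ _ _ BL BM BE BT hL hM hE hT => ?_⟩
  have := h℘.isPrime
  let t : LocalPoint K P := ⟨α, ℘, h℘, Sα⟩
  have hs {r s : ℕ} {A : Matrix (Fin r) (Fin s) S} {B : Matrix (Fin r) (Fin s) Sα}
      (hAB : MatSpec (LocElemSpec P ℘) A B) : Entrywise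
        (FracRel ((algebraMap (Rg k m n) S).comp (toR k m n)) t.toLocal) A B :=
    fun i j => LocElemSpec.fracRel t (hAB i j)
  obtain ⟨h1, h2⟩ := h α hα t rfl
  exact ⟨h1 BL BM BE (hs hL) (hs hM) (hs hE), h2 BL BM BT (hs hL) (hs hM) (hs hT)⟩

end Spl
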